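/- Let p, q ∈ ℂ[z] be polynomials without multiple roots with 2 ≤ deg p ≤ deg q and deg q ≥ 3. Let F : ⟨LND(D_p)⟩ → ⟨LND(D_q)⟩ be an isomorphism of Lie algebras. Then F is induced by an isomorphism of varieties D_p ≅ D_q: there exists a ℂ-algebra isomorphism φ* : O(D_q) → O(D_p) such that F(δ) = (φ*)⁻¹ ∘ δ ∘ φ* for every δ ∈ ⟨LND(D_p)⟩. -/

import Mathlib

open Polynomial

set_option synthInstance.maxHeartbeats 400000
set_option maxHeartbeats 800000

noncomputable section

/-- The polynomial ring `ℂ[x,y,z]` (variables indexed by `Fin 3`). -/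
abbrev P3 : Type := MvPolynomial (Fin 3) ℂ

/-- The variable `x`. -/
def xP : P3 := MvPolynomial.X 0
/-- The variable `y`. -/
def yP : P3 := MvPolynomial.X 1
/-- The variable `z`. -/
def zP : P3 := MvPolynomial.X 2

/-- The ideal `(xy - p(z)) ⊆ ℂ[x,y,z]`. -/
def relIdeal (p : ℂ[X]) : Ideal P3 := Ideal.span {xP * yP - Polynomial.aeval zP p}

/-- The coordinate ring `O(D_p) = ℂ[x,y,z]/(xy - p(z))` of the Danielewski surface `D_p`. -/
abbrev ODan (p : ℂ[X]) : Type := P3 ⧸ relIdeal p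

/-- A derivation is locally nilpotent if some power of it kills each element. -/
def IsLND {p : ℂ[X]} (δ : Derivation ℂ (ODan p) (ODan p)) : Prop :=
  ∀ f : ODan p, ∃ n : ℕ, 1 ≤ n ∧ (δ.toLinearMap ^ n) f = 0

/-- The Lie subalgebra `⟨LND(D_p)⟩` of `Der_ℂ(O(D_p))` generated by all locally
nilpotent derivations. -/
def lndSpan (p : ℂ[X]) : LieSubalgebra ℂ (Derivation ℂ (ODan p) (ODan p)) :=
  LieSubalgebra.lieSpan ℂ _ {δ | IsLND δ}

/-! ### The ambient field -/

/-- Exponents, ordered lexicographically. -/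
abbrev Gm : Type := ℤ ×ₗ ℤ

/-- A field of generalized power series in `z` and `x`. -/
def KK : Type := HahnSeries Gm ℂ

instance : Field KK := inferInstanceAs (Field (HahnSeries Gm ℂ))
instance : Algebra ℂ KK := inferInstanceAs (Algebra ℂ (HahnSeries Gm ℂ))

/-- coefficient of `z^j x^i`. -/
def cf (j i : ℤ) : KK →ₗ[ℂ] ℂ where
  toFun f := HahnSeries.coeff (show HahnSeries Gm ℂ from f) (toLex (j, i))
  map_add' _ _ := rfl
  map_smul' _ _ := rfl

lemma cf_ext {f g : KK} (h : ∀ j i, cf j i f = cf j i g) : f = g := by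
  refine HahnSeries.ext (x := (show HahnSeries Gm ℂ from f)) (y := (show HahnSeries Gm ℂ from g)) ?_
  funext a
  exact h (ofLex a).1 (ofLex a).2

/-- The weight operator on Hahn series. -/
def wtFun (w : Gm →+ ℤ) (f : HahnSeries Gm ℂ) : HahnSeries Gm ℂ where
  coeff a := (w a : ℂ) * f.coeff a
  isPWO_support' := f.isPWO_support.mono (by
    intro a ha
    simp only [Function.mem_support, ne_eq, mul_eq_zero, not_or] at ha
    exact ha.2)

lemma wtFun_mul (w : Gm →+ ℤ) (f g : HahnSeries Gm ℂ) :
    wtFun w (f * g) = f * wtFun w g + g * wtFun w f := by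
  have hs : ∀ h : HahnSeries Gm ℂ, (wtFun w h).support ⊆ h.support := by
    intro h a ha
    have : (w a : ℂ) * h.coeff a ≠ 0 := ha
    exact (mul_ne_zero_iff.1 this).2
  ext a
  rw [mul_comm g]
  rw [HahnSeries.coeff_add, HahnSeries.coeff_mul_right' g.isPWO_support (hs g),
    HahnSeries.coeff_mul_left' f.isPWO_support (hs f)]
  change (w a : ℂ) * (f * g).coeff a = _
  rw [HahnSeries.coeff_mul, Finset.mul_sum, ← Finset.sum_add_distrib]
  refine Finset.sum_congr rfl ?_
  intro ij hij
  have : ij.1 + ij.2 = a := by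
    simp only [Finset.mem_antidiagonal] at hij
    exact hij.2.2
  change _ = f.coeff ij.1 * ((w ij.2 : ℂ) * g.coeff ij.2) + (w ij.1 : ℂ) * f.coeff ij.1 * g.coeff ij.2
  rw [← this, map_add]
  push_cast
  ring

/-- The weight derivation. -/
def wtDer (w : Gm →+ ℤ) : Derivation ℂ KK KK :=
  Derivation.mk'
    { toFun := fun f => (wtFun w f : HahnSeries Gm ℂ)
      map_add' := by
        intro f g
        refine HahnSeries.ext (Γ := Gm) (R := ℂ) ?_
        funext a
        exact mul_add _ _ _
      map_smul' := by
        intro c f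
        refine HahnSeries.ext (Γ := Gm) (R := ℂ) ?_
        funext a
        exact mul_left_comm _ _ _ }
    (fun f g => wtFun_mul w f g)

/-- The element `z`. -/
def zK : KK := (HahnSeries.single (toLex ((1 : ℤ), (0 : ℤ)) : Gm) (1 : ℂ) : HahnSeries Gm ℂ)
/-- The element `x`. -/
def xK : KK := (HahnSeries.single (toLex ((0 : ℤ), (1 : ℤ)) : Gm) (1 : ℂ) : HahnSeries Gm ℂ)

lemma cf_zK_mul (j i : ℤ) (f : KK) : cf j i (zK * f) = cf (j - 1) i f := by
  have := HahnSeries.coeff_single_mul (Γ' := Gm) (R := ℂ) (r := 1)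
    (x := (show HahnSeries Gm ℂ from f)) (a := toLex (j, i)) (b := toLex ((1 : ℤ), (0 : ℤ)))
  rw [one_mul, ← toLex_sub, Prod.mk_sub_mk, sub_zero] at this
  exact this

lemma cf_xK_mul (j i : ℤ) (f : KK) : cf j i (xK * f) = cf j (i - 1) f := by
  have := HahnSeries.coeff_single_mul (Γ' := Gm) (R := ℂ) (r := 1)
    (x := (show HahnSeries Gm ℂ from f)) (a := toLex (j, i)) (b := toLex ((0 : ℤ), (1 : ℤ)))
  rw [one_mul, ← toLex_sub, Prod.mk_sub_mk, sub_zero] at this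
  exact this

lemma cf_one (j i : ℤ) : cf j i (1 : KK) = if j = 0 ∧ i = 0 then 1 else 0 := by
  have := HahnSeries.coeff_one (Γ := Gm) (R := ℂ) (a := toLex (j, i))
  have h2 : (toLex (j, i) = (0 : Gm)) ↔ (j = 0 ∧ i = 0) := by
    rw [← toLex_zero, toLex_inj]
    exact Prod.mk_eq_zero
  simp only [h2] at this
  exact this

lemma zK_ne : zK ≠ 0 := by
  intro h
  have := cf_zK_mul 1 0 1
  rw [h, zero_mul, map_zero, cf_one] at this
  simp at this

lemma xK_ne : xK ≠ 0 := by
  intro h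
  have := cf_xK_mul 0 1 1
  rw [h, zero_mul, map_zero, cf_one] at this
  simp at this

/-- first weight -/
def w1 : Gm →+ ℤ where
  toFun a := (ofLex a).1
  map_zero' := rfl
  map_add' _ _ := rfl
/-- second weight -/
def w2 : Gm →+ ℤ where
  toFun a := (ofLex a).2
  map_zero' := rfl
  map_add' _ _ := rfl

/-- `∂/∂z`. -/
def D1 : Derivation ℂ KK KK := zK⁻¹ • wtDer w1
/-- `x ∂/∂x`. -/
def D2 : Derivation ℂ KK KK := wtDer w2

lemma cf_D2 (j i : ℤ) (f : KK) : cf j i (D2 f) = (i : ℂ) * cf j i f := rfl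

lemma cf_wt1 (j i : ℤ) (f : KK) : cf j i (wtDer w1 f) = (j : ℂ) * cf j i f := rfl

lemma cf_D1 (j i : ℤ) (f : KK) : cf j i (D1 f) = ((j + 1 : ℤ) : ℂ) * cf (j + 1) i f := by
  have h : wtDer w1 f = zK * D1 f := by
    change _ = zK * (zK⁻¹ * wtDer w1 f)
    rw [mul_inv_cancel_left₀ zK_ne]
  have := cf_wt1 (j + 1) i f
  rw [h, cf_zK_mul] at this
  simpa using this

lemma D_comm (f : KK) : D1 (D2 f) = D2 (D1 f) := by
  refine cf_ext fun j i => ?_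
  rw [cf_D1, cf_D2, cf_D2, cf_D1]
  ring

lemma D1_z : D1 zK = 1 := by
  refine cf_ext fun j i => ?_
  have := cf_zK_mul (j + 1) i 1
  rw [mul_one] at this
  rw [cf_D1, this, cf_one, cf_one]
  by_cases h : j = 0 ∧ i = 0
  · simp [h]
  · have : ¬ (j + 1 - 1 = 0 ∧ i = 0) := by simpa using h
    rw [if_neg h, if_neg this, mul_zero]

lemma D2_z : D2 zK = 0 := by
  refine cf_ext fun j i => ?_
  have := cf_zK_mul j i 1
  rw [mul_one] at this
  rw [cf_D2, this, cf_one, map_zero]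
  split_ifs with h
  · simp [h.2]
  · simp

lemma D1_x : D1 xK = 0 := by
  refine cf_ext fun j i => ?_
  have := cf_xK_mul (j + 1) i 1
  rw [mul_one] at this
  rw [cf_D1, this, cf_one, map_zero]
  split_ifs with h
  · simp [h.1]
  · simp

lemma D2_x : D2 xK = xK := by
  refine cf_ext fun j i => ?_
  have := cf_xK_mul j i 1
  rw [mul_one] at this
  rw [cf_D2, this, cf_one]
  split_ifs with h
  · have : i = 1 := by omega
    simp [this]
  · simp

/-! ### The bracket -/

/-- The Poisson bracket on the ambient field. -/
def br (f g : KK) : KK := D1 f * D2 g - D2 f * D1 g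

lemma br_add_left (f f' g : KK) : br (f + f') g = br f g + br f' g := by simp only [br, map_add]; ring
lemma br_add_right (f g g' : KK) : br f (g + g') = br f g + br f g' := by simp only [br, map_add]; ring
lemma br_sub_left (f f' g : KK) : br (f - f') g = br f g - br f' g := by simp only [br, map_sub]; ring
lemma br_sub_right (f g g' : KK) : br f (g - g') = br f g - br f g' := by simp only [br, map_sub]; ring
lemma br_smul_left (c : ℂ) (f g : KK) : br (c • f) g = c • br f g := by
  rw [br, br, Derivation.map_smul, Derivation.map_smul]; simp only [Algebra.smul_def]; ring
lemma br_smul_right (c : ℂ) (f g : KK) : br f (c • g) = c • br f g := by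
  rw [br, br, Derivation.map_smul, Derivation.map_smul]; simp only [Algebra.smul_def]; ring
lemma br_zero_left (g : KK) : br 0 g = 0 := by simp [br]
lemma br_zero_right (g : KK) : br g 0 = 0 := by simp [br]
lemma br_self (g : KK) : br g g = 0 := by simp only [br]; ring
lemma br_swap (f g : KK) : br f g = - br g f := by simp only [br]; ring
lemma br_mul_right (f g h : KK) : br f (g * h) = g * br f h + h * br f g := by
  simp only [br, Derivation.leibniz, smul_eq_mul]; ring
lemma br_mul_left (f g h : KK) : br (f * g) h = f * br g h + g * br f h := by
  simp only [br, Derivation.leibniz, smul_eq_mul]; ring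
lemma br_jacobi (f g h : KK) : br f (br g h) = br (br f g) h + br g (br f h) := by
  simp only [br, Derivation.leibniz, map_sub, smul_eq_mul, D_comm]; ring
lemma br_plucker (a b c d : KK) : br a c * br b d = br a d * br b c + br a b * br c d := by
  simp only [br]; ring
lemma br_const_right (f : KK) (c : ℂ) : br f (algebraMap ℂ KK c) = 0 := by simp [br]
lemma br_const_left (f : KK) (c : ℂ) : br (algebraMap ℂ KK c) f = 0 := by simp [br]
lemma br_pow_right (f g : KK) (n : ℕ) : br f (g ^ (n + 1)) = ((n : KK) + 1) * g ^ n * br f g := by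
  simp only [br, Derivation.leibniz_pow, smul_eq_mul, nsmul_eq_mul]; push_cast; ring
lemma br_pow_left (f g : KK) (n : ℕ) : br (g ^ (n + 1)) f = ((n : KK) + 1) * g ^ n * br g f := by
  rw [br_swap, br_pow_right, br_swap g f]; ring

lemma br_zK_left (f : KK) : br zK f = D2 f := by simp [br, D1_z, D2_z]
lemma br_xK_left (f : KK) : br xK f = - xK * D1 f := by simp [br, D1_x, D2_x]

/-- The bracket as a derivation in the second argument. -/
def brDer (f : KK) : Derivation ℂ KK KK := D1 f • D2 - D2 f • D1
lemma brDer_apply (f g : KK) : brDer f g = br f g := rfl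

lemma casimir {f : KK} (h1 : br f zK = 0) (h2 : br f xK = 0) : ∃ c : ℂ, f = algebraMap ℂ KK c := by
  rw [br_swap, br_zK_left, neg_eq_zero] at h1
  rw [br_swap, br_xK_left, neg_eq_zero] at h2
  have h2' : D1 f = 0 := by
    have := mul_eq_zero.1 h2
    simpa [xK_ne] using this
  refine ⟨cf 0 0 f, cf_ext fun j i => ?_⟩
  rw [Algebra.algebraMap_eq_smul_one, map_smul, cf_one, smul_eq_mul]
  by_cases hi : i = 0
  · by_cases hj : j = 0
    · simp [hi, hj]
    · have := cf_D1 (j - 1) i f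
      rw [h2', map_zero] at this
      simp only [sub_add_cancel, zero_eq_mul, Int.cast_eq_zero, hj, false_or] at this
      simp [hj, this]
  · have := cf_D2 j i f
    rw [h1, map_zero] at this
    simp only [zero_eq_mul, Int.cast_eq_zero, hi, false_or] at this
    simp [hi, this]

lemma casimir' {f : KK} (h : ∀ g, br f g = 0) : ∃ c : ℂ, f = algebraMap ℂ KK c :=
  casimir (h _) (h _)

/-! ### The coordinate ring inside the ambient field -/

/-- `x` in the coordinate ring. -/
def xA (p : ℂ[X]) : ODan p := Ideal.Quotient.mk (relIdeal p) xP
/-- `y` in the coordinate ring. -/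
def yA (p : ℂ[X]) : ODan p := Ideal.Quotient.mk (relIdeal p) yP
/-- `z` in the coordinate ring. -/
def zA (p : ℂ[X]) : ODan p := Ideal.Quotient.mk (relIdeal p) zP

lemma mk_aeval_zP (p c : ℂ[X]) :
    Ideal.Quotient.mk (relIdeal p) (aeval zP c) = aeval (zA p) c := by
  have := Polynomial.aeval_algHom_apply (Ideal.Quotient.mkₐ ℂ (relIdeal p)) zP c
  exact this.symm

lemma xA_mul_yA (p : ℂ[X]) : xA p * yA p = aeval (zA p) p := by
  rw [← mk_aeval_zP, xA, yA, ← map_mul]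
  rw [Ideal.Quotient.eq]
  exact Ideal.subset_span rfl

lemma ODan_induction {p : ℂ[X]} {P : ODan p → Prop} (hC : ∀ c : ℂ, P (algebraMap ℂ (ODan p) c))
    (hx : P (xA p)) (hy : P (yA p)) (hz : P (zA p)) (hadd : ∀ f g, P f → P g → P (f + g))
    (hmul : ∀ f g, P f → P g → P (f * g)) (f : ODan p) : P f := by
  obtain ⟨f, rfl⟩ := Ideal.Quotient.mk_surjective f
  induction f using MvPolynomial.induction_on with
  | C a => exact hC a
  | add f g hf hg => rw [map_add]; exact hadd _ _ hf hg
  | mul_X f n hf =>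
    rw [map_mul]
    refine hmul _ _ hf ?_
    fin_cases n
    · exact hx
    · exact hy
    · exact hz

/-- The embedding on polynomials. -/
def iotaP (p : ℂ[X]) : P3 →ₐ[ℂ] KK := MvPolynomial.aeval ![xK, aeval zK p * xK⁻¹, zK]

lemma iotaP_x (p : ℂ[X]) : iotaP p xP = xK := by simp [iotaP, xP]
lemma iotaP_y (p : ℂ[X]) : iotaP p yP = aeval zK p * xK⁻¹ := by simp [iotaP, yP]
lemma iotaP_z (p : ℂ[X]) : iotaP p zP = zK := by simp [iotaP, zP]

/-- The embedding of the coordinate ring. -/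
def iota (p : ℂ[X]) : ODan p →ₐ[ℂ] KK :=
  Ideal.Quotient.liftₐ (relIdeal p) (iotaP p) (by
    intro a ha
    have : relIdeal p ≤ RingHom.ker (iotaP p) := by
      rw [relIdeal, Ideal.span_le, Set.singleton_subset_iff]
      change iotaP p _ = 0
      rw [map_sub, map_mul, iotaP_x, iotaP_y, ← Polynomial.aeval_algHom_apply, iotaP_z]
      field_simp [xK_ne]
      ring
    exact this ha)

lemma iota_x (p : ℂ[X]) : iota p (xA p) = xK := iotaP_x p
lemma iota_y (p : ℂ[X]) : iota p (yA p) = aeval zK p * xK⁻¹ := iotaP_y p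
lemma iota_z (p : ℂ[X]) : iota p (zA p) = zK := iotaP_z p
lemma iota_zc (p c : ℂ[X]) : iota p (aeval (zA p) c) = aeval zK c := by
  rw [← Polynomial.aeval_algHom_apply, iota_z]

/-- Basic homogeneous elements. -/
def nf (p : ℂ[X]) (i : ℤ) : ℂ[X] →ₗ[ℂ] ODan p :=
  (LinearMap.mulLeft ℂ (xA p ^ i.toNat * yA p ^ (-i).toNat)) ∘ₗ (aeval (zA p)).toLinearMap

lemma nf_apply (p : ℂ[X]) (i : ℤ) (c : ℂ[X]) :
    nf p i c = xA p ^ i.toNat * yA p ^ (-i).toNat * aeval (zA p) c := rfl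

/-- Normal form. -/
def Nf (p : ℂ[X]) : (ℤ →₀ ℂ[X]) →ₗ[ℂ] ODan p := Finsupp.lsum ℂ (fun i => nf p i)

lemma Nf_single (p : ℂ[X]) (i : ℤ) (c : ℂ[X]) : Nf p (Finsupp.single i c) = nf p i c := by
  simp [Nf]

lemma nf_mul_x (p : ℂ[X]) (i : ℤ) (c : ℂ[X]) : ∃ c', nf p i c * xA p = nf p (i + 1) c' := by
  rcases le_or_gt 0 i with h | h
  · refine ⟨c, ?_⟩
    have h1 : (i + 1).toNat = i.toNat + 1 := by omega
    have h2 : (-(i + 1)).toNat = (-i).toNat := by omega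
    rw [nf_apply, nf_apply, h1, h2]; ring
  · refine ⟨p * c, ?_⟩
    have h1 : (i + 1).toNat = i.toNat := by omega
    have h2 : (-i).toNat = (-(i + 1)).toNat + 1 := by omega
    rw [nf_apply, nf_apply, h1, h2, map_mul, ← xA_mul_yA]; ring

lemma nf_mul_y (p : ℂ[X]) (i : ℤ) (c : ℂ[X]) : ∃ c', nf p i c * yA p = nf p (i - 1) c' := by
  rcases le_or_gt i 0 with h | h
  · refine ⟨c, ?_⟩
    have h1 : (-(i - 1)).toNat = (-i).toNat + 1 := by omega
    have h2 : (i - 1).toNat = i.toNat := by omega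
    rw [nf_apply, nf_apply, h1, h2]; ring
  · refine ⟨p * c, ?_⟩
    have h1 : (-(i - 1)).toNat = (-i).toNat := by omega
    have h2 : i.toNat = (i - 1).toNat + 1 := by omega
    rw [nf_apply, nf_apply, h1, h2, map_mul, ← xA_mul_yA]; ring

lemma nf_mul_z (p : ℂ[X]) (i : ℤ) (c : ℂ[X]) : nf p i c * zA p = nf p i (c * X) := by
  rw [nf_apply, nf_apply, map_mul, aeval_X]; ring

lemma Nf_surj (p : ℂ[X]) (f : ODan p) : ∃ b, f = Nf p b := by
  have key : ∀ t : ODan p, (∀ i c, ∃ i' c', nf p i c * t = nf p i' c') →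
      ∀ b, ∃ b', Nf p b * t = Nf p b' := by
    intro t ht b
    induction b using Finsupp.induction_linear with
    | zero => exact ⟨0, by simp⟩
    | add f g hf hg =>
      obtain ⟨f', hf⟩ := hf
      obtain ⟨g', hg⟩ := hg
      exact ⟨f' + g', by rw [map_add, map_add, add_mul, hf, hg]⟩
    | single i c =>
      obtain ⟨i', c', h⟩ := ht i c
      exact ⟨Finsupp.single i' c', by rw [Nf_single, Nf_single, h]⟩
  obtain ⟨f, rfl⟩ := Ideal.Quotient.mk_surjective f
  induction f using MvPolynomial.induction_on with
  | C a =>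
    refine ⟨Finsupp.single 0 (C a), ?_⟩
    rw [Nf_single, nf_apply, aeval_C]
    simp
    rfl
  | add f g hf hg =>
    obtain ⟨f', hf⟩ := hf
    obtain ⟨g', hg⟩ := hg
    exact ⟨f' + g', by rw [map_add, map_add, hf, hg]⟩
  | mul_X f n hf =>
    obtain ⟨b, hb⟩ := hf
    rw [map_mul, hb]
    refine key _ ?_ b
    intro i c
    fin_cases n
    · obtain ⟨c', h⟩ := nf_mul_x p i c
      exact ⟨_, c', h⟩
    · obtain ⟨c', h⟩ := nf_mul_y p i c
      exact ⟨_, c', h⟩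
    · exact ⟨_, _, nf_mul_z p i c⟩

lemma iota_nf (p : ℂ[X]) (i : ℤ) (c : ℂ[X]) :
    iota p (nf p i c) = xK ^ i * aeval zK (p ^ (-i).toNat * c) := by
  rw [nf_apply, map_mul, map_mul, map_pow, map_pow, iota_x, iota_y, iota_zc, mul_pow, map_mul, map_pow]
  have : (xK ^ i : KK) = xK ^ i.toNat * (xK⁻¹) ^ (-i).toNat := by
    rw [inv_pow, ← zpow_natCast, ← zpow_natCast, ← zpow_neg, ← zpow_add₀ xK_ne]
    congr 1
    omega
  rw [this]; ring

/-! ### Rows -/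

lemma cf_zpow_mul (m : ℤ) : ∀ (j i : ℤ) (f : KK), cf j i (xK ^ m * f) = cf j (i - m) f := by
  induction m using Int.induction_on with
  | zero => intro j i f; simp
  | succ n ih =>
    intro j i f
    rw [zpow_add₀ xK_ne, zpow_one, mul_assoc, ih, cf_xK_mul]
    congr 2; ring
  | pred n ih =>
    intro j i f
    have h := cf_xK_mul j (i + 1) (xK ^ (-(n : ℤ) - 1) * f)
    rw [← mul_assoc, ← zpow_one_add₀ xK_ne] at h
    have e : (1 + (-(n : ℤ) - 1)) = -n := by ring
    rw [e, ih] at h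
    rw [add_sub_cancel_right] at h
    rw [← h]
    congr 2; ring

lemma cf_zK_pow (n : ℕ) : ∀ j i : ℤ, cf j i (zK ^ n) = if j = n ∧ i = 0 then 1 else 0 := by
  induction n with
  | zero => intro j i; rw [pow_zero, cf_one]; simp
  | succ n ih =>
    intro j i
    rw [pow_succ', cf_zK_mul, ih]
    have : (j - 1 = n ∧ i = 0) ↔ (j = (n + 1 : ℕ) ∧ i = 0) := by
      push_cast
      omega
    simp only [this]

lemma cf_aeval (c : ℂ[X]) (j i : ℤ) :
    cf j i (aeval zK c) = if i = 0 then (if 0 ≤ j then c.coeff j.toNat else 0) else 0 := by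
  induction c using Polynomial.induction_on' with
  | add f g hf hg =>
    rw [map_add, map_add, hf, hg]
    split_ifs <;> simp
  | monomial n a =>
    rw [← C_mul_X_pow_eq_monomial, map_mul, aeval_C, map_pow, aeval_X, ← Algebra.smul_def, map_smul,
      cf_zK_pow]
    by_cases hi : i = 0
    · by_cases hj : 0 ≤ j
      · have : (j = n) ↔ (j.toNat = n) := by omega
        simp [hi, hj, coeff_X_pow, this]
      · have : ¬ (j = n) := by omega
        simp [hi, hj, this]
    · simp [hi]

/-- The `x^i`-row of `f` is the polynomial `a`. -/
def Row (f : KK) (i : ℤ) (a : ℂ[X]) : Prop :=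
  ∀ j : ℤ, cf j i f = if 0 ≤ j then a.coeff j.toNat else 0

lemma Row.unique {f : KK} {i : ℤ} {a b : ℂ[X]} (ha : Row f i a) (hb : Row f i b) : a = b := by
  ext n
  have h1 := ha n
  have h2 := hb n
  rw [h1] at h2
  simpa using h2

lemma Row.add {f g : KK} {i : ℤ} {a b : ℂ[X]} (ha : Row f i a) (hb : Row g i b) :
    Row (f + g) i (a + b) := by
  intro j
  rw [map_add, ha j, hb j]
  split_ifs <;> simp

lemma Row.smul {f : KK} {i : ℤ} {a : ℂ[X]} (c : ℂ) (ha : Row f i a) :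
    Row (c • f) i (c • a) := by
  intro j
  rw [map_smul, ha j]
  split_ifs <;> simp

lemma Row.zero (i : ℤ) : Row 0 i 0 := by
  intro j; simp

lemma Row.D1 {f : KK} {i : ℤ} {a : ℂ[X]} (ha : Row f i a) : Row (D1 f) i (derivative a) := by
  intro j
  rw [cf_D1, ha]
  by_cases hj : 0 ≤ j
  · have h1 : (j + 1).toNat = j.toNat + 1 := by omega
    have h2 : ((j : ℤ) : ℂ) = (j.toNat : ℂ) := by
      have h3 : j = (j.toNat : ℤ) := (Int.toNat_of_nonneg hj).symm
      have h4 : (j : ℂ) = ((j.toNat : ℤ) : ℂ) := congrArg _ h3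
      rw [h4, Int.cast_natCast]
    rw [if_pos hj, if_pos (by omega), coeff_derivative, h1]
    push_cast
    rw [h2]; ring
  · by_cases hj' : j + 1 = 0
    · rw [if_neg hj, hj']; simp
    · rw [if_neg hj, if_neg (by omega), mul_zero]

lemma Row.D2 {f : KK} {i : ℤ} {a : ℂ[X]} (ha : Row f i a) : Row (D2 f) i ((i : ℂ) • a) := by
  intro j
  rw [cf_D2, ha]
  split_ifs <;> simp

lemma Row.xmul {f : KK} {i : ℤ} {a : ℂ[X]} (ha : Row f i a) : Row (xK * f) (i + 1) a := by
  intro j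
  rw [cf_xK_mul, add_sub_cancel_right, ha]

lemma Row.mono (m : ℤ) (c : ℂ[X]) (i : ℤ) : Row (xK ^ m * aeval zK c) i (if i = m then c else 0) := by
  intro j
  rw [cf_zpow_mul, cf_aeval]
  by_cases h : i = m
  · simp [h]
  · have : ¬ (i - m = 0) := by omega
    simp [h, this]

lemma row_Nf (p : ℂ[X]) (b : ℤ →₀ ℂ[X]) (i : ℤ) : Row (iota p (Nf p b)) i (p ^ (-i).toNat * b i) := by
  induction b using Finsupp.induction_linear with
  | zero => simpa using Row.zero i
  | add f g hf hg =>
    rw [map_add, map_add, Finsupp.add_apply, mul_add]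
    exact hf.add hg
  | single m c =>
    rw [Nf_single, iota_nf]
    have := Row.mono m (p ^ (-m).toNat * c) i
    by_cases h : i = m
    · subst h; simpa using this
    · rw [if_neg h] at this
      rw [Finsupp.single_apply, if_neg (fun h' => h h'.symm), mul_zero]
      exact this

lemma iota_inj {p : ℂ[X]} (hp : p ≠ 0) : Function.Injective (iota p) := by
  rw [injective_iff_map_eq_zero]
  intro f hf
  obtain ⟨b, rfl⟩ := Nf_surj p f
  have : b = 0 := by
    ext1 i
    have h := row_Nf p b i
    rw [hf] at h
    have := h.unique (Row.zero i)
    simpa [hp] using this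
  rw [this, map_zero]

/-! ### Hamiltonian derivations -/

lemma D1_aeval (c : ℂ[X]) : D1 (aeval zK c) = aeval zK (derivative c) := by
  rw [Derivation.map_aeval, D1_z]; simp
lemma D2_aeval (c : ℂ[X]) : D2 (aeval zK c) = 0 := by
  rw [Derivation.map_aeval, D2_z]; simp

lemma br_zx : br zK xK = xK := by rw [br_zK_left, D2_x]

lemma D2_y (p : ℂ[X]) : D2 (aeval zK p * xK⁻¹) = - (aeval zK p * xK⁻¹) := by
  rw [Derivation.leibniz, D2_aeval, Derivation.leibniz_inv, D2_x]
  simp only [smul_eq_mul]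
  field_simp [xK_ne]; ring
lemma D1_y (p : ℂ[X]) : D1 (aeval zK p * xK⁻¹) = aeval zK (derivative p) * xK⁻¹ := by
  rw [Derivation.leibniz, D1_aeval, Derivation.leibniz_inv, D1_x]
  simp only [smul_eq_mul]
  field_simp [xK_ne]; ring

lemma br_zy (p : ℂ[X]) : br zK (aeval zK p * xK⁻¹) = - (aeval zK p * xK⁻¹) := by
  rw [br_zK_left, D2_y]

lemma br_xy (p : ℂ[X]) : br xK (aeval zK p * xK⁻¹) = - aeval zK (derivative p) := by
  rw [br_xK_left, D1_y]
  field_simp [xK_ne]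

lemma br_closed (p : ℂ[X]) (f g : ODan p) : ∃ h, iota p h = br (iota p f) (iota p g) := by
  have sw : ∀ f g : ODan p, (∃ h, iota p h = br (iota p f) (iota p g)) →
      ∃ h, iota p h = br (iota p g) (iota p f) := by
    rintro f g ⟨h, hh⟩
    exact ⟨-h, by rw [map_neg, hh, ← br_swap]⟩
  have red : ∀ f : ODan p, (∃ h, iota p h = br (iota p f) (iota p (xA p))) →
      (∃ h, iota p h = br (iota p f) (iota p (yA p))) →
      (∃ h, iota p h = br (iota p f) (iota p (zA p))) →
      ∀ g, ∃ h, iota p h = br (iota p f) (iota p g) := by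
    intro f hx hy hz g
    induction g using ODan_induction with
    | hC c => exact ⟨0, by rw [AlgHom.commutes, br_const_right, map_zero]⟩
    | hx => exact hx
    | hy => exact hy
    | hz => exact hz
    | hadd a b ha hb =>
      obtain ⟨a', ha⟩ := ha
      obtain ⟨b', hb⟩ := hb
      exact ⟨a' + b', by rw [map_add, map_add, br_add_right, ha, hb]⟩
    | hmul a b ha hb =>
      obtain ⟨a', ha⟩ := ha
      obtain ⟨b', hb⟩ := hb
      exact ⟨a * b' + b * a', by rw [map_add, map_mul, map_mul, map_mul, br_mul_right, ha, hb]⟩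
  have hzx : ∃ h, iota p h = br (iota p (zA p)) (iota p (xA p)) :=
    ⟨xA p, by rw [iota_x, iota_z, br_zx]⟩
  have hzy : ∃ h, iota p h = br (iota p (zA p)) (iota p (yA p)) :=
    ⟨-yA p, by rw [map_neg, iota_y, iota_z, br_zy]⟩
  have hxy : ∃ h, iota p h = br (iota p (xA p)) (iota p (yA p)) :=
    ⟨-aeval (zA p) (derivative p), by rw [map_neg, iota_zc, iota_x, iota_y, br_xy]⟩
  have hs : ∀ f, ∃ h, iota p h = br (iota p f) (iota p f) := fun f => ⟨0, by rw [br_self, map_zero]⟩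
  refine red f ?_ ?_ ?_ g
  · exact sw _ _ (red _ (hs _) hxy (sw _ _ hzx) f)
  · exact sw _ _ (red _ (sw _ _ hxy) (hs _) (sw _ _ hzy) f)
  · exact sw _ _ (red _ hzx hzy (hs _) f)

/-- The Poisson bracket on the coordinate ring. -/
def pb (p : ℂ[X]) (f g : ODan p) : ODan p := (br_closed p f g).choose

lemma iota_pb (p : ℂ[X]) (f g : ODan p) : iota p (pb p f g) = br (iota p f) (iota p g) :=
  (br_closed p f g).choose_spec

/-- The Hamiltonian derivation of `f`. -/
def ham (p : ℂ[X]) (hp : p ≠ 0) (f : ODan p) : Derivation ℂ (ODan p) (ODan p) :=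
  Derivation.mk'
    { toFun := pb p f
      map_add' := fun a b => iota_inj hp (by
        rw [map_add, iota_pb, iota_pb, iota_pb, map_add, br_add_right])
      map_smul' := fun c a => iota_inj hp (by
        rw [RingHom.id_apply, iota_pb, map_smul, map_smul, br_smul_right, iota_pb]) }
    (fun a b => iota_inj hp (by
      simp only [LinearMap.coe_mk, AddHom.coe_mk, smul_eq_mul]
      rw [map_add, map_mul, map_mul, iota_pb, iota_pb, iota_pb, map_mul, br_mul_right]))

lemma iota_ham (p : ℂ[X]) (hp : p ≠ 0) (f g : ODan p) :
    iota p (ham p hp f g) = br (iota p f) (iota p g) := iota_pb p f g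

lemma ham_apply (p : ℂ[X]) (hp : p ≠ 0) (f g : ODan p) : ham p hp f g = pb p f g := rfl

lemma ham_add (p : ℂ[X]) (hp : p ≠ 0) (f g : ODan p) : ham p hp (f + g) = ham p hp f + ham p hp g := by
  ext1 h
  apply iota_inj hp
  rw [Derivation.add_apply, map_add, iota_ham, iota_ham, iota_ham, map_add, br_add_left]

lemma ham_smul (p : ℂ[X]) (hp : p ≠ 0) (c : ℂ) (f : ODan p) : ham p hp (c • f) = c • ham p hp f := by
  ext1 h
  apply iota_inj hp
  rw [Derivation.smul_apply, map_smul, iota_ham, iota_ham, map_smul, br_smul_left]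

lemma ham_lie (p : ℂ[X]) (hp : p ≠ 0) (f g : ODan p) :
    ⁅ham p hp f, ham p hp g⁆ = ham p hp (pb p f g) := by
  ext1 h
  apply iota_inj hp
  rw [Derivation.commutator_apply, map_sub]
  simp only [iota_ham, iota_pb]
  rw [br_jacobi]; ring

lemma der_ext {p : ℂ[X]} {M : Type*} [AddCommGroup M] [Module ℂ M] [Module (ODan p) M]
    {d e : Derivation ℂ (ODan p) M}
    (hx : d (xA p) = e (xA p)) (hy : d (yA p) = e (yA p)) (hz : d (zA p) = e (zA p)) : d = e := by
  ext1 f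
  induction f using ODan_induction with
  | hC c => simp
  | hx => exact hx
  | hy => exact hy
  | hz => exact hz
  | hadd a b ha hb => rw [map_add, map_add, ha, hb]
  | hmul a b ha hb => rw [Derivation.leibniz, Derivation.leibniz, ha, hb]

/-! ### Constants are not sums of brackets -/

/-- Elements whose zeroth row is a derivative of a multiple of `p`. -/
def NN (p : ℂ[X]) : Submodule ℂ KK where
  carrier := {f | ∃ h : ℂ[X], Row f 0 (derivative (p * h))}
  add_mem' := by
    rintro f g ⟨h, hh⟩ ⟨k, hk⟩
    refine ⟨h + k, ?_⟩
    rw [mul_add, map_add]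
    exact hh.add hk
  zero_mem' := ⟨0, by simpa using Row.zero 0⟩
  smul_mem' := by
    rintro c f ⟨h, hh⟩
    refine ⟨c • h, ?_⟩
    rw [mul_smul_comm, derivative_smul]
    exact hh.smul c

lemma D1_zpow (i : ℤ) : D1 (xK ^ i) = 0 := by
  rw [Derivation.leibniz_zpow, D1_x]; simp
lemma D2_zpow (i : ℤ) : D2 (xK ^ i) = (i : KK) * xK ^ i := by
  rw [Derivation.leibniz_zpow, D2_x]
  simp only [smul_eq_mul, zsmul_eq_mul]
  rw [zpow_sub_one₀ xK_ne]
  field_simp [xK_ne]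

lemma br_mono (i j : ℤ) (a b : ℂ[X]) :
    br (xK ^ i * aeval zK a) (xK ^ j * aeval zK b) =
      xK ^ (i + j) * aeval zK ((j : ℂ) • (derivative a * b) - (i : ℂ) • (a * derivative b)) := by
  simp only [br, Derivation.leibniz, D1_zpow, D2_zpow, D1_aeval, D2_aeval, smul_eq_mul]
  rw [zpow_add₀ xK_ne, map_sub, map_smul, map_smul, map_mul, map_mul]
  simp only [Algebra.smul_def, map_intCast]
  ring

lemma br_mem_NN (p : ℂ[X]) (f g : ODan p) : br (iota p f) (iota p g) ∈ NN p := by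
  obtain ⟨b, rfl⟩ := Nf_surj p f
  obtain ⟨c, rfl⟩ := Nf_surj p g
  induction b using Finsupp.induction_linear with
  | zero => simp [br_zero_left]
  | add f g hf hg => rw [map_add, map_add, br_add_left]; exact add_mem hf hg
  | single i a =>
    induction c using Finsupp.induction_linear with
    | zero => simp [br_zero_right]
    | add f g hf hg => rw [map_add, map_add, br_add_right]; exact add_mem hf hg
    | single j b =>
      rw [Nf_single, Nf_single, iota_nf, iota_nf, br_mono]
      set a' := p ^ (-i).toNat * a with ha'
      set b' := p ^ (-j).toNat * b with hb'
      have hr := Row.mono (i + j) ((j : ℂ) • (derivative a' * b') - (i : ℂ) • (a' * derivative b')) 0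
      by_cases h : 0 = i + j
      · rw [if_pos h] at hr
        have hj : j = -i := by omega
        by_cases hi : i = 0
        · refine ⟨0, ?_⟩
          have hj0 : j = 0 := by omega
          simpa [hi, hj0] using hr
        · have hd : p ∣ a' * b' := by
            rcases lt_or_gt_of_ne hi with h1 | h1
            · refine Dvd.dvd.mul_right (Dvd.dvd.mul_right (dvd_pow_self p ?_) _) _
              omega
            · refine Dvd.dvd.mul_left (Dvd.dvd.mul_right (dvd_pow_self p ?_) _) _
              omega
          obtain ⟨k, hk⟩ := hd
          refine ⟨(-(i : ℂ)) • k, ?_⟩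
          rw [mul_smul_comm, ← hk, derivative_smul, (derivative_mul : derivative (a' * b') = derivative a' * b' + a' * derivative b')]
          have e : (j : ℂ) • (derivative a' * b') - (i : ℂ) • (a' * derivative b') =
              (-(i : ℂ)) • (derivative a' * b' + a' * derivative b') := by
            rw [hj]; push_cast; module
          rw [← e]; exact hr
      · rw [if_neg h] at hr
        exact ⟨0, by simpa using hr⟩

lemma row_const (c : ℂ) : Row (algebraMap ℂ KK c) 0 (C c) := by
  have := Row.mono 0 (C c) 0
  simpa using this

lemma NN_const {p : ℂ[X]} (hp : 2 ≤ p.natDegree) {c : ℂ} (h : algebraMap ℂ KK c ∈ NN p) : c = 0 := by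
  obtain ⟨k, hk⟩ := h
  have e := (row_const c).unique hk
  by_cases hk0 : k = 0
  · simpa [hk0] using e
  · have hp0 : p ≠ 0 := by rintro rfl; simp at hp
    have h1 : (p * k).natDegree = p.natDegree + k.natDegree := natDegree_mul hp0 hk0
    have h2 : (derivative (p * k)).natDegree = (p * k).natDegree - 1 := natDegree_derivative _
    rw [← e, natDegree_C] at h2
    omega

/-! ### Derivations -/

lemma der_formula {p : ℂ[X]} (δ : Derivation ℂ (ODan p) (ODan p)) (g : ODan p) :
    iota p (δ g) = D1 (iota p g) * iota p (δ (zA p)) + D2 (iota p g) * (iota p (δ (xA p)) * xK⁻¹) := by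
  induction g using ODan_induction with
  | hC c => simp
  | hx => rw [iota_x, D1_x, D2_x]; field_simp [xK_ne]; ring
  | hz => rw [iota_z, D1_z, D2_z]; ring
  | hy =>
    have h := congrArg δ (xA_mul_yA p)
    rw [Derivation.leibniz, Derivation.map_aeval] at h
    have h2 := congrArg (iota p) h
    simp only [smul_eq_mul, map_add, map_mul, iota_x, iota_y, iota_zc] at h2
    rw [iota_y, D1_y, D2_y]
    apply mul_left_cancel₀ xK_ne
    rw [eq_sub_of_add_eq h2]
    field_simp [xK_ne]
    ring
  | hadd a b ha hb => rw [map_add, map_add, ha, hb, map_add, map_add, map_add]; ring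
  | hmul a b ha hb =>
    rw [Derivation.leibniz, map_add, smul_eq_mul, smul_eq_mul, map_mul, map_mul, ha, hb, map_mul,
      Derivation.leibniz, Derivation.leibniz]
    simp only [smul_eq_mul]; ring

lemma iterate_leibniz {A : Type*} [CommRing A] [Algebra ℂ A] (δ : Derivation ℂ A A) :
    ∀ (N m n : ℕ) (f g : A), m + n = N → δ^[m + 1] f = 0 → δ^[n + 1] g = 0 →
      ∃ c : ℕ, c ≠ 0 ∧ δ^[N] (f * g) = c • (δ^[m] f * δ^[n] g) := by
  have hadd : ∀ (N : ℕ) (a b : A), δ^[N] (a + b) = δ^[N] a + δ^[N] b := by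
    intro N a b
    exact iterate_map_add δ N a b
  have h0 : ∀ N, δ^[N] (0 : A) = 0 := by
    intro N
    exact iterate_map_zero δ N
  intro N
  induction N with
  | zero =>
    intro m n f g h _ _
    obtain rfl : m = 0 := by omega
    obtain rfl : n = 0 := by omega
    exact ⟨1, one_ne_zero, by simp⟩
  | succ N ih =>
    intro m n f g h hf hg
    have e : δ^[N + 1] (f * g) = δ^[N] (f * δ g) + δ^[N] (δ f * g) := by
      rw [Function.iterate_succ_apply, Derivation.leibniz, hadd, smul_eq_mul, smul_eq_mul, mul_comm g]
    rcases m with _ | m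
    · rcases n with _ | n
      · omega
      · obtain ⟨c, hc, h1⟩ := ih 0 n f (δ g) (by omega) hf (by simpa using hg)
        refine ⟨c, hc, ?_⟩
        have : δ f = 0 := by simpa using hf
        rw [e, h1, this, zero_mul, h0, add_zero]
        rfl
    · rcases n with _ | n
      · obtain ⟨c, hc, h1⟩ := ih m 0 (δ f) g (by omega) (by simpa using hf) hg
        refine ⟨c, hc, ?_⟩
        have : δ g = 0 := by simpa using hg
        rw [e, h1, this, mul_zero, h0, zero_add]
        rfl
      · obtain ⟨c, hc, h1⟩ := ih (m + 1) n f (δ g) (by omega) hf (by simpa using hg)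
        obtain ⟨c', hc', h1'⟩ := ih m (n + 1) (δ f) g (by omega) (by simpa using hf) hg
        refine ⟨c + c', by omega, ?_⟩
        rw [e, h1, h1', add_smul]
        rfl

lemma lnd_eigen {p : ℂ[X]} (hp : p ≠ 0) {δ : Derivation ℂ (ODan p) (ODan p)} (hδ : IsLND δ)
    {D a : ODan p} (h : δ a = D * a) (hD : D ≠ 0) : a = 0 := by
  by_contra ha
  have key : ∀ f : ODan p, f ≠ 0 → ∃ n, δ^[n] f ≠ 0 ∧ δ^[n + 1] f = 0 := by
    intro f hf
    obtain ⟨n, -, hn⟩ := hδ f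
    rw [Module.End.pow_apply] at hn
    by_contra hcon
    push Not at hcon
    have : ∀ n, δ^[n] f ≠ 0 := by
      intro n
      induction n with
      | zero => exact hf
      | succ n ih => exact hcon n ih
    exact this n hn
  obtain ⟨m, hm, hm'⟩ := key D hD
  obtain ⟨n, hn, hn'⟩ := key a ha
  obtain ⟨c, hc, e⟩ := iterate_leibniz δ (m + n) m n D a rfl hm' hn'
  rw [← h, ← Function.iterate_succ_apply, show (m + n).succ = m + (n + 1) by omega,
    Function.iterate_add_apply, hn'] at e
  have h0 : δ^[m] (0 : ODan p) = 0 := by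
    exact iterate_map_zero δ m
  rw [h0] at e
  have e2 := congrArg (iota p) e
  rw [map_zero, map_nsmul, map_mul, nsmul_eq_mul] at e2
  have inj := iota_inj hp
  have e3 := mul_eq_zero.1 e2.symm
  rcases e3 with e3 | e3
  · have hch : CharZero KK := charZero_of_injective_algebraMap (algebraMap ℂ KK).injective
    exact hc (by exact_mod_cast e3)
  · rcases mul_eq_zero.1 e3 with e4 | e4
    · exact hm (inj (by rw [e4, map_zero]))
    · exact hn (inj (by rw [e4, map_zero]))

/-- The defect of a derivation to be Poisson. -/
def defect {p : ℂ[X]} (hp : p ≠ 0) (δ : Derivation ℂ (ODan p) (ODan p)) (f : ODan p) :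
    Derivation ℂ (ODan p) (ODan p) := ⁅δ, ham p hp f⁆ - ham p hp (δ f)

lemma defect_apply {p : ℂ[X]} (hp : p ≠ 0) (δ : Derivation ℂ (ODan p) (ODan p)) (f g : ODan p) :
    defect hp δ f g = δ (pb p f g) - pb p f (δ g) - pb p (δ f) g := rfl

lemma pb_swap {p : ℂ[X]} (hp : p ≠ 0) (f g : ODan p) : pb p f g = - pb p g f := by
  apply iota_inj hp
  rw [map_neg, iota_pb, iota_pb, br_swap]

lemma defect_swap {p : ℂ[X]} (hp : p ≠ 0) (δ : Derivation ℂ (ODan p) (ODan p)) (f g : ODan p) :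
    defect hp δ f g = - defect hp δ g f := by
  rw [defect_apply, defect_apply, pb_swap hp f g, pb_swap hp f (δ g), pb_swap hp (δ f) g, map_neg]
  ring

lemma defect_eq {p : ℂ[X]} (hp : p ≠ 0) (δ : Derivation ℂ (ODan p) (ODan p)) (f g : ODan p) :
    iota p (defect hp δ f g) =
      br (iota p f) (iota p g) * (iota p (defect hp δ (zA p) (xA p)) * xK⁻¹) := by
  have hs : ∀ a, iota p (defect hp δ a a) = 0 := by
    intro a
    have := congrArg (iota p) (defect_swap hp δ a a)
    rw [map_neg] at this
    have hch : CharZero KK := charZero_of_injective_algebraMap (algebraMap ℂ KK).injective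
    exact self_eq_neg.1 this
  rw [der_formula (defect hp δ f) g, defect_swap hp δ f (zA p), defect_swap hp δ f (xA p), map_neg,
    map_neg, der_formula (defect hp δ (zA p)) f, der_formula (defect hp δ (xA p)) f, hs, hs,
    defect_swap hp δ (xA p) (zA p), map_neg, br]
  field_simp [xK_ne]
  ring

/-- A derivation compatible with the bracket. -/
def IsPD {p : ℂ[X]} (δ : Derivation ℂ (ODan p) (ODan p)) : Prop :=
  ∀ f g, δ (pb p f g) = pb p (δ f) g + pb p f (δ g)

lemma coprime_deriv {p : ℂ[X]} (hsp : Squarefree p) : IsCoprime p (derivative p) :=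
  (PerfectField.separable_iff_squarefree.2 hsp)

lemma lnd_isPD {p : ℂ[X]} (hp : p ≠ 0) (hsp : Squarefree p) {δ : Derivation ℂ (ODan p) (ODan p)}
    (hδ : IsLND δ) : IsPD δ := by
  obtain ⟨u, v, huv⟩ := coprime_deriv hsp
  set d1 := defect hp δ (zA p) (xA p) with hd1
  set D : ODan p := aeval (zA p) u * d1 * yA p - aeval (zA p) v * defect hp δ (xA p) (yA p) with hD
  have hDi : iota p D = iota p d1 * xK⁻¹ := by
    have h1 := congrArg (aeval zK) huv
    rw [map_add, map_mul, map_mul, map_one] at h1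
    rw [hD, map_sub, map_mul, map_mul, map_mul, iota_zc, iota_zc, iota_y, defect_eq hp δ (xA p) (yA p),
      iota_x, iota_y, br_xy, ← hd1]
    linear_combination (iota p d1 * xK⁻¹) * h1
  have hdef : ∀ f g, defect hp δ f g = D * pb p f g := by
    intro f g
    apply iota_inj hp
    rw [defect_eq, map_mul, hDi, iota_pb, mul_comm]
  have hD0 : D = 0 := by
    by_contra hne
    have key : ∀ (N m n : ℕ) (f g : ODan p), m + n = N → δ^[m] f = 0 → δ^[n] g = 0 → pb p f g = 0 := by
      intro N
      induction N with
      | zero =>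
        intro m n f g h hf hg
        obtain rfl : m = 0 := by omega
        have : f = 0 := hf
        apply iota_inj hp
        rw [this, iota_pb, map_zero, br_zero_left]
      | succ N ih =>
        intro m n f g h hf hg
        rcases m with _ | m
        · have : f = 0 := hf
          apply iota_inj hp
          rw [this, iota_pb, map_zero, br_zero_left]
        rcases n with _ | n
        · have : g = 0 := hg
          apply iota_inj hp
          rw [this, iota_pb, map_zero, br_zero_right]
        refine lnd_eigen hp hδ ?_ hne
        have e := hdef f g
        rw [defect_apply, ih (m + 1) n f (δ g) (by omega) hf hg,
          ih m (n + 1) (δ f) g (by omega) hf hg] at e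
        simpa using e
    obtain ⟨m, -, hm⟩ := hδ (zA p)
    obtain ⟨n, -, hn⟩ := hδ (xA p)
    rw [Module.End.pow_apply] at hm hn
    have := congrArg (iota p) (key _ m n _ _ rfl hm hn)
    rw [iota_pb, iota_z, iota_x, br_zx, map_zero] at this
    exact xK_ne this
  intro f g
  have := hdef f g
  rw [hD0, zero_mul, defect_apply] at this
  linear_combination this

lemma exists_antideriv (c : ℂ[X]) : ∃ P : ℂ[X], derivative P = c := by
  induction c using Polynomial.induction_on' with
  | add f g hf hg =>
    obtain ⟨a, rfl⟩ := hf
    obtain ⟨b, rfl⟩ := hg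
    exact ⟨a + b, by simp⟩
  | monomial n a =>
    refine ⟨monomial (n + 1) (a / (n + 1)), ?_⟩
    rw [derivative_monomial]
    have : (n : ℂ) + 1 ≠ 0 := by exact_mod_cast Nat.succ_ne_zero n
    simp only [Nat.add_sub_cancel]
    push_cast
    rw [div_mul_cancel₀ _ this]

lemma row_ext {f g : KK} (h : ∀ i, ∃ a, Row f i a ∧ Row g i a) : f = g := by
  refine cf_ext fun j i => ?_
  obtain ⟨a, h1, h2⟩ := h i
  rw [h1 j, h2 j]

lemma pd_isHam {p : ℂ[X]} (hp2 : 2 ≤ p.natDegree) (hp : p ≠ 0) {δ : Derivation ℂ (ODan p) (ODan p)}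
    (hδ : IsPD δ) : ∃ f, δ = ham p hp f := by
  obtain ⟨α, hα⟩ := Nf_surj p (δ (zA p))
  obtain ⟨β, hβ⟩ := Nf_surj p (δ (xA p))
  have hzx : pb p (zA p) (xA p) = xA p := by
    apply iota_inj hp
    rw [iota_pb, iota_z, iota_x, br_zx]
  have rel := congrArg (iota p) (hδ (zA p) (xA p))
  rw [hzx, map_add, iota_pb, iota_pb, iota_x, iota_z, br_zK_left, br_swap, br_xK_left, neg_mul,
    neg_neg, hα, hβ] at rel
  set a : ℤ → ℂ[X] := fun i => p ^ (-i).toNat * α i with ha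
  set b : ℤ → ℂ[X] := fun i => p ^ (-i).toNat * β i with hb
  have rowa : ∀ i, Row (iota p (Nf p α)) i (a i) := row_Nf p α
  have rowb : ∀ i, Row (iota p (Nf p β)) i (b i) := row_Nf p β
  have relr : ∀ i : ℤ, derivative (a i) = (-(i : ℂ)) • b (i + 1) := by
    intro i
    have h1 := ((rowa i).D1.xmul).add (rowb (i + 1)).D2
    rw [← rel] at h1
    have h2 := (rowb (i + 1)).unique h1
    have h3 : derivative (a i) = b (i + 1) - ((i + 1 : ℤ) : ℂ) • b (i + 1) := by
      exact eq_sub_of_add_eq h2.symm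
    rw [h3]; push_cast; module
  obtain ⟨P, hP⟩ := exists_antideriv (b 1)
  set φ : ℤ →₀ ℂ[X] := Finsupp.onFinset α.support (fun i => (-(i : ℂ)⁻¹) • α i) (by
    intro i hi
    rw [Finsupp.mem_support_iff]
    intro h0
    exact hi (by rw [h0, smul_zero])) + Finsupp.single 0 P with hφ
  have hφ0 : φ 0 = P := by simp [hφ]
  have hφi : ∀ i : ℤ, i ≠ 0 → φ i = (-(i : ℂ)⁻¹) • α i := by
    intro i hi
    simp [hφ, hi, Finsupp.single_apply, hi.symm]
  set f := Nf p φ with hf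
  set c : ℤ → ℂ[X] := fun i => p ^ (-i).toNat * φ i with hc
  have rowf : ∀ i, Row (iota p f) i (c i) := row_Nf p φ
  have hc0 : c 0 = P := by simp [hc, hφ0]
  have hci : ∀ i : ℤ, i ≠ 0 → c i = (-(i : ℂ)⁻¹) • a i := by
    intro i hi
    simp only [hc, ha]
    rw [hφi i hi, mul_smul_comm]
  have hx : δ (xA p) = ham p hp f (xA p) := by
    apply iota_inj hp
    rw [iota_ham, iota_x, br_swap, br_xK_left, neg_mul, neg_neg, hβ]
    apply row_ext
    intro i
    refine ⟨b i, rowb i, ?_⟩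
    have h1 := (rowf (i - 1)).D1.xmul
    rw [sub_add_cancel] at h1
    convert h1 using 1
    by_cases hi : i - 1 = 0
    · rw [hi, hc0, hP]
      congr 1; omega
    · rw [hci _ hi, derivative_smul, relr, sub_add_cancel, smul_smul]
      have : ((i - 1 : ℤ) : ℂ) ≠ 0 := by exact_mod_cast hi
      rw [neg_mul_neg, inv_mul_cancel₀ this, one_smul]
  have h0 : derivative (a 0) = 0 := by
    rw [relr 0]; simp
  have hlam : a 0 = C ((a 0).coeff 0) := eq_C_of_derivative_eq_zero h0
  set lam := (a 0).coeff 0 with hlamdef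
  have hz : iota p ((δ - ham p hp f) (zA p)) = algebraMap ℂ KK lam := by
    rw [Derivation.sub_apply, map_sub, iota_ham, iota_z, br_swap, br_zK_left, sub_neg_eq_add, hα]
    have e : algebraMap ℂ KK lam = xK ^ (0 : ℤ) * aeval zK (C lam) := by simp
    rw [e]
    apply row_ext
    intro i
    refine ⟨_, (rowa i).add (rowf i).D2, ?_⟩
    convert Row.mono 0 (C lam) i using 1
    by_cases hi : i = 0
    · rw [if_pos hi, hi, hlam]; simp
    · rw [if_neg hi, hci i hi, smul_smul]
      have : (i : ℂ) ≠ 0 := by exact_mod_cast hi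
      rw [mul_neg, mul_inv_cancel₀ this]; simp
  have hx' : (δ - ham p hp f) (xA p) = 0 := by rw [Derivation.sub_apply, hx, sub_self]
  have hy := der_formula (δ - ham p hp f) (yA p)
  rw [hx', map_zero, zero_mul, mul_zero, add_zero, iota_y, D1_y, hz] at hy
  have hlam0 : lam = 0 := by
    by_contra hne
    obtain ⟨γ, hγ⟩ := Nf_surj p ((δ - ham p hp f) (yA p))
    have h1 := (row_Nf p γ (-1)).xmul
    rw [← hγ, hy] at h1
    have e : xK * (aeval zK (derivative p) * xK⁻¹ * (algebraMap ℂ KK) lam) =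
        xK ^ (0 : ℤ) * aeval zK (C lam * derivative p) := by
      rw [map_mul, aeval_C, zpow_zero]
      field_simp [xK_ne]
    rw [e] at h1
    have h2 := h1.unique (Row.mono 0 (C lam * derivative p) (-1 + 1))
    rw [if_pos (by norm_num)] at h2
    have hd : p ∣ derivative p := by
      have : p ∣ C lam * derivative p := by
        rw [← h2]; exact ⟨γ (-1), by rw [show (- -1 : ℤ).toNat = 1 from rfl, pow_one]⟩
      exact (IsUnit.dvd_mul_left (isUnit_C.2 (Ne.isUnit hne))).1 this
    have hdeg : (derivative p).natDegree = p.natDegree - 1 := natDegree_derivative _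
    have hne' : derivative p ≠ 0 := by
      intro h
      rw [h, natDegree_zero] at hdeg
      omega
    have := natDegree_le_of_dvd hd hne'
    omega
  refine ⟨f, sub_eq_zero.1 (der_ext ?_ ?_ ?_)⟩
  · rw [hx']; rfl
  · apply iota_inj hp
    rw [hy, hlam0]; simp
  · apply iota_inj hp
    rw [hz, hlam0]; simp

lemma span_isHam {p : ℂ[X]} (hsp : Squarefree p) (hp2 : 2 ≤ p.natDegree) (hp : p ≠ 0)
    {δ : Derivation ℂ (ODan p) (ODan p)} (hδ : δ ∈ lndSpan p) : ∃ f, δ = ham p hp f := by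
  refine LieSubalgebra.lieSpan_induction (R := ℂ) (L := Derivation ℂ (ODan p) (ODan p))
    (p := fun δ _ => ∃ f, δ = ham p hp f) ?_ ?_ ?_ ?_ ?_ hδ
  · intro d hd
    exact pd_isHam hp2 hp (lnd_isPD hp hsp hd)
  · exact ⟨0, by
      have := ham_smul p hp 0 0
      rw [zero_smul, zero_smul] at this
      exact this.symm⟩
  · rintro d e _ _ ⟨f, rfl⟩ ⟨g, rfl⟩
    exact ⟨f + g, by rw [ham_add]⟩
  · rintro c d _ ⟨f, rfl⟩
    exact ⟨c • f, by rw [ham_smul]⟩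
  · rintro d e _ _ ⟨f, rfl⟩ ⟨g, rfl⟩
    exact ⟨pb p f g, by rw [ham_lie]⟩

/-! ### Hamiltonians of the Lie algebra generated by locally nilpotent derivations -/

/-- The subalgebra of elements killed by a power of `δ`. -/
def Nil {A : Type*} [CommRing A] [Algebra ℂ A] (δ : Derivation ℂ A A) : Subalgebra ℂ A where
  carrier := {f | ∃ n : ℕ, δ^[n] f = 0}
  algebraMap_mem' := fun c => ⟨1, by simp⟩
  add_mem' := by
    rintro f g ⟨m, hm⟩ ⟨n, hn⟩
    refine ⟨m + n, ?_⟩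
    rw [iterate_map_add δ, Function.iterate_add_apply δ m n g, hn, iterate_map_zero δ, add_comm m n,
      Function.iterate_add_apply δ n m f, hm, iterate_map_zero δ, add_zero]
  mul_mem' := by
    have key : ∀ (N m n : ℕ) (f g : A), m + n = N → δ^[m] f = 0 → δ^[n] g = 0 → δ^[N] (f * g) = 0 := by
      intro N
      induction N with
      | zero =>
        intro m n f g h hf hg
        obtain rfl : m = 0 := by omega
        have : f = 0 := hf
        rw [this, zero_mul]; rfl
      | succ N ih =>
        intro m n f g h hf hg
        rcases m with _ | m
        · have : f = 0 := hf
          rw [this, zero_mul, iterate_map_zero δ]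
        rcases n with _ | n
        · have : g = 0 := hg
          rw [this, mul_zero, iterate_map_zero δ]
        rw [Function.iterate_succ_apply, Derivation.leibniz, iterate_map_add δ, smul_eq_mul, smul_eq_mul,
          mul_comm g, ih (m + 1) n f (δ g) (by omega) hf hg, ih m (n + 1) (δ f) g (by omega) hf hg, add_zero]
    rintro f g ⟨m, hm⟩ ⟨n, hn⟩
    exact ⟨m + n, key _ m n f g rfl hm hn⟩

lemma mem_Nil_of {A : Type*} [CommRing A] [Algebra ℂ A] {δ : Derivation ℂ A A} {f : A}
    (h : δ f ∈ Nil δ) : f ∈ Nil δ := by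
  obtain ⟨n, hn⟩ := h
  exact ⟨n + 1, hn⟩

lemma isLND_of_Nil {p : ℂ[X]} {δ : Derivation ℂ (ODan p) (ODan p)} (hx : xA p ∈ Nil δ)
    (hy : yA p ∈ Nil δ) (hz : zA p ∈ Nil δ) : IsLND δ := by
  intro f
  have hf : f ∈ Nil δ := by
    induction f using ODan_induction with
    | hC c => exact Subalgebra.algebraMap_mem _ c
    | hx => exact hx
    | hy => exact hy
    | hz => exact hz
    | hadd a b ha hb => exact add_mem ha hb
    | hmul a b ha hb => exact mul_mem ha hb
  obtain ⟨n, hn⟩ := hf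
  refine ⟨n + 1, by omega, ?_⟩
  rw [Module.End.pow_apply]
  change δ^[n + 1] f = 0
  rw [add_comm, Function.iterate_add_apply, hn]
  simp

lemma aeval_mem_sub {A : Type*} [CommRing A] [Algebra ℂ A] (S : Subalgebra ℂ A) {a : A} (ha : a ∈ S)
    (c : ℂ[X]) : aeval a c ∈ S := by
  induction c using Polynomial.induction_on' with
  | add f g hf hg => rw [map_add]; exact add_mem hf hg
  | monomial n c =>
    rw [aeval_monomial]
    exact mul_mem (S.algebraMap_mem c) (pow_mem ha n)

/-- The function `p(z)/x`. -/
def yK (p : ℂ[X]) : KK := aeval zK p * xK⁻¹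

lemma lnd_x (p : ℂ[X]) (hp : p ≠ 0) (i : ℕ) : IsLND (ham p hp (xA p ^ (i + 1))) := by
  have hx : xA p ∈ Nil (ham p hp (xA p ^ (i + 1))) := by
    apply mem_Nil_of
    have : ham p hp (xA p ^ (i + 1)) (xA p) = 0 := by
      apply iota_inj hp
      rw [iota_ham, map_pow, iota_x, br_pow_left, br_self, mul_zero, map_zero]
    rw [this]; exact zero_mem _
  have hz : zA p ∈ Nil (ham p hp (xA p ^ (i + 1))) := by
    apply mem_Nil_of
    have : ham p hp (xA p ^ (i + 1)) (zA p) = - (((i + 1 : ℕ) : ODan p) * (xA p) ^ (i + 1)) := by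
      apply iota_inj hp
      rw [iota_ham, map_pow, iota_x, iota_z, br_pow_left, br_swap, br_zx, map_neg, map_mul, map_natCast,
        map_pow, iota_x]
      push_cast; ring
    rw [this]
    exact neg_mem (mul_mem (natCast_mem _ _) (pow_mem hx _))
  refine isLND_of_Nil hx ?_ hz
  apply mem_Nil_of
  have : ham p hp (xA p ^ (i + 1)) (yA p) =
      - (((i + 1 : ℕ) : ODan p) * (xA p) ^ i * aeval (zA p) (derivative p)) := by
    apply iota_inj hp
    rw [iota_ham, map_pow, iota_x, iota_y, br_pow_left, br_xy, map_neg, map_mul, map_mul, map_natCast,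
      map_pow, iota_x, iota_zc]
    push_cast; ring
  rw [this]
  exact neg_mem (mul_mem (mul_mem (natCast_mem _ _) (pow_mem hx _)) (aeval_mem_sub _ hz _))

lemma lnd_y (p : ℂ[X]) (hp : p ≠ 0) : IsLND (ham p hp (yA p)) := by
  have hy : yA p ∈ Nil (ham p hp (yA p)) := by
    apply mem_Nil_of
    have : ham p hp (yA p) (yA p) = 0 := by
      apply iota_inj hp
      rw [iota_ham, br_self, map_zero]
    rw [this]; exact zero_mem _
  have hz : zA p ∈ Nil (ham p hp (yA p)) := by
    apply mem_Nil_of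
    have : ham p hp (yA p) (zA p) = yA p := by
      apply iota_inj hp
      rw [iota_ham, br_swap, iota_y, iota_z, br_zy, neg_neg]
    rw [this]
    exact hy
  refine isLND_of_Nil ?_ hy hz
  apply mem_Nil_of
  have : ham p hp (yA p) (xA p) = aeval (zA p) (derivative p) := by
    apply iota_inj hp
    rw [iota_ham, br_swap, iota_y, iota_x, br_xy, neg_neg, iota_zc]
  rw [this]
  exact aeval_mem_sub _ hz _

lemma ham_zero (p : ℂ[X]) (hp : p ≠ 0) : ham p hp 0 = 0 := by
  have := ham_smul p hp 0 0
  rwa [zero_smul, zero_smul] at this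

/-- Hamiltonian functions, inside the ambient field. -/
def WW (p : ℂ[X]) (hp : p ≠ 0) : Submodule ℂ KK where
  carrier := {u | ∃ f : ODan p, iota p f = u ∧ ham p hp f ∈ lndSpan p}
  zero_mem' := ⟨0, map_zero _, by rw [ham_zero]; exact zero_mem _⟩
  add_mem' := by
    rintro _ _ ⟨f, rfl, hf⟩ ⟨g, rfl, hg⟩
    exact ⟨f + g, map_add _ _ _, by rw [ham_add]; exact add_mem hf hg⟩
  smul_mem' := by
    rintro c _ ⟨f, rfl, hf⟩
    exact ⟨c • f, map_smul _ _ _, by rw [ham_smul]; exact (lndSpan p).smul_mem c hf⟩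

lemma WW_br {p : ℂ[X]} {hp : p ≠ 0} {u v : KK} (hu : u ∈ WW p hp) (hv : v ∈ WW p hp) : br u v ∈ WW p hp := by
  obtain ⟨f, rfl, hf⟩ := hu
  obtain ⟨g, rfl, hg⟩ := hv
  exact ⟨pb p f g, iota_pb p f g, by rw [← ham_lie]; exact (lndSpan p).lie_mem hf hg⟩

lemma ham_const (p : ℂ[X]) (hp : p ≠ 0) (c : ℂ) : ham p hp (algebraMap ℂ _ c) = 0 := by
  ext1 g
  apply iota_inj hp
  rw [iota_ham, AlgHom.commutes, br_const_left]
  simp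

lemma WW_const (p : ℂ[X]) (hp : p ≠ 0) (c : ℂ) : algebraMap ℂ KK c ∈ WW p hp :=
  ⟨algebraMap ℂ _ c, AlgHom.commutes _ _, by rw [ham_const]; exact zero_mem _⟩

lemma WW_x (p : ℂ[X]) (hp : p ≠ 0) (i : ℕ) : xK ^ i ∈ WW p hp := by
  rcases i with _ | i
  · simpa using WW_const p hp 1
  · exact ⟨xA p ^ (i + 1), by rw [map_pow, iota_x], LieSubalgebra.subset_lieSpan (lnd_x p hp i)⟩

lemma WW_y (p : ℂ[X]) (hp : p ≠ 0) : yK p ∈ WW p hp :=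
  ⟨yA p, iota_y p, LieSubalgebra.subset_lieSpan (lnd_y p hp)⟩

/-- Monomials in `x` with polynomial coefficients in `z`. -/
def mo (i : ℤ) (a : ℂ[X]) : KK := xK ^ i * aeval zK a

lemma mo_add (i : ℤ) (a b : ℂ[X]) : mo i (a + b) = mo i a + mo i b := by
  rw [mo, map_add, mul_add]; rfl
lemma mo_smul (i : ℤ) (c : ℂ) (a : ℂ[X]) : mo i (c • a) = c • mo i a := by
  rw [mo, map_smul, mul_smul_comm]; rfl
lemma mo_mul (i j : ℤ) (a b : ℂ[X]) : mo i a * mo j b = mo (i + j) (a * b) := by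
  rw [mo, mo, mo, map_mul, zpow_add₀ xK_ne]; ring
lemma mo_natone (i : ℕ) : mo i 1 = xK ^ i := by
  rw [mo, map_one, mul_one, zpow_natCast]
lemma yK_mo (p : ℂ[X]) : yK p = mo (-1) p := by
  rw [mo, zpow_neg_one, mul_comm]; rfl
lemma mo_pow (i : ℤ) (a : ℂ[X]) (n : ℕ) : mo i a ^ n = mo (n * i) (a ^ n) := by
  rw [mo, mo, mul_pow, map_pow, mul_comm (n : ℤ), zpow_mul, zpow_natCast]
lemma br_mo (i j : ℤ) (a b : ℂ[X]) : br (mo i a) (mo j b) =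
    mo (i + j) ((j : ℂ) • (derivative a * b) - (i : ℂ) • (a * derivative b)) := br_mono i j a b

lemma mo_const {i : ℤ} (hi : i ≠ 0) {a : ℂ[X]} {c : ℂ} (h : mo i a = algebraMap ℂ KK c) : a = 0 := by
  have h1 := Row.mono i a i
  have h2 : Row (algebraMap ℂ KK c) i 0 := by
    have := Row.mono 0 (C c) i
    rw [if_neg hi] at this
    simpa using this
  rw [if_pos rfl] at h1
  change Row (mo i a) i a at h1
  rw [h] at h1
  exact h1.unique h2

lemma br_y_mo (p a : ℂ[X]) (i : ℤ) : br (yK p) (mo i a) =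
    mo (i - 1) ((i : ℂ) • (derivative p * a) + p * derivative a) := by
  rw [yK_mo, br_mo]
  congr 1
  · ring
  · push_cast; module

lemma br_x_mo (a : ℂ[X]) (i : ℤ) : br xK (mo i a) = mo (i + 1) (- derivative a) := by
  have : xK = mo 1 1 := by rw [mo, map_one, zpow_one, mul_one]
  conv_lhs => rw [this]
  rw [br_mo, add_comm]
  congr 1
  simp

lemma mo_deriv {p : ℂ[X]} {hp : p ≠ 0} {i : ℤ} {a : ℂ[X]} (h : mo i a ∈ WW p hp) (n : ℕ) :
    mo (i + n) (derivative^[n] a) ∈ WW p hp := by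
  induction n with
  | zero => simpa using h
  | succ n ih =>
    have := (WW p hp).smul_mem (-1 : ℂ) (WW_br (by simpa using WW_x p hp 1) ih)
    rw [br_x_mo, ← mo_smul] at this
    rw [Function.iterate_succ_apply']
    convert this using 2
    · push_cast; ring
    · simp

lemma pow_deriv (p a : ℂ[X]) (n : ℕ) : p ^ n * (((n + 1 : ℕ) : ℂ) • (derivative p * a) + p * derivative a) =
    derivative (p ^ (n + 1) * a) := by
  rw [derivative_mul, derivative_pow_succ, smul_eq_C_mul]
  push_cast
  ring

lemma natDegree_iter (a : ℂ[X]) (n : ℕ) : (derivative^[n] a).natDegree = a.natDegree - n := by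
  induction n with
  | zero => simp
  | succ n ih => rw [Function.iterate_succ_apply', natDegree_derivative, ih]; omega

lemma WW_S {p : ℂ[X]} (hp : p ≠ 0) (hp2 : 2 ≤ p.natDegree) (k : ℕ) :
    ∃ N : ℕ, ∀ i : ℤ, N ≤ i → ∀ a : ℂ[X], a.natDegree ≤ k → mo i a ∈ WW p hp := by
  induction k with
  | zero =>
    refine ⟨0, fun i hi a ha => ?_⟩
    obtain ⟨n, rfl⟩ := Int.eq_ofNat_of_zero_le hi
    rw [eq_C_of_natDegree_le_zero ha, ← mul_one (C _), ← smul_eq_C_mul, mo_smul]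
    refine (WW p hp).smul_mem _ ?_
    have := mo_natone n
    rw [this]
    exact WW_x p hp n
  | succ k ih =>
    obtain ⟨N, hN⟩ := ih
    refine ⟨N + p.natDegree, fun i hi a ha => ?_⟩
    obtain ⟨n, hn⟩ : ∃ n : ℕ, i = (n : ℤ) + (p.natDegree - 2 : ℕ) :=
      ⟨(i - (p.natDegree - 2 : ℕ)).toNat, by omega⟩
    have h1 : mo ((n + 1 : ℕ) : ℤ) (X ^ k) ∈ WW p hp := hN _ (by omega) _ (natDegree_X_pow_le k)
    have h2 := WW_br (WW_y p hp) h1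
    rw [br_y_mo] at h2
    set b := (((n + 1 : ℕ) : ℤ) : ℂ) • (derivative p * X ^ k) + p * derivative (X ^ k) with hb
    have hbd : b.natDegree = p.natDegree + k - 1 := by
      have e := pow_deriv p (X ^ k) n
      rw [← Int.cast_natCast, ← hb] at e
      have h3 := congrArg natDegree e
      have hX : (X ^ k : ℂ[X]) ≠ 0 := pow_ne_zero _ X_ne_zero
      rw [natDegree_derivative, natDegree_mul (pow_ne_zero _ hp) hX, natDegree_pow, natDegree_X_pow] at h3
      have hb0 : b ≠ 0 := by
        intro h0
        rw [h0, mul_zero, natDegree_zero] at h3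
        have : p.natDegree ≤ (n + 1) * p.natDegree := Nat.le_mul_of_pos_left _ (by omega)
        omega
      rw [natDegree_mul (pow_ne_zero _ hp) hb0, natDegree_pow, add_mul] at h3
      omega
    have h4 := mo_deriv h2 (p.natDegree - 2)
    set c := derivative^[p.natDegree - 2] b with hc
    have hcd : c.natDegree = k + 1 := by rw [hc, natDegree_iter, hbd]; omega
    have h5 : mo i c ∈ WW p hp := by
      convert h4 using 2
      rw [hn]; push_cast; ring
    have hc0 : c.coeff (k + 1) ≠ 0 := by
      rw [← hcd]
      have : c ≠ 0 := by rintro h; rw [h, natDegree_zero] at hcd; omega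
      simpa using this
    have e : a = (a - (a.coeff (k + 1) / c.coeff (k + 1)) • c) + (a.coeff (k + 1) / c.coeff (k + 1)) • c := by
      ring
    rw [e, mo_add, mo_smul]
    refine add_mem (hN i (by omega) _ ?_) ((WW p hp).smul_mem _ h5)
    rw [natDegree_le_iff_coeff_eq_zero]
    intro m hm
    rw [coeff_sub, coeff_smul, smul_eq_mul]
    rcases eq_or_lt_of_le (Nat.succ_le_of_lt hm) with h | h
    · rw [← h, Nat.succ_eq_add_one, div_mul_cancel₀ _ hc0, sub_self]
    · rw [coeff_eq_zero_of_natDegree_lt (p := a) (n := m) (by omega), coeff_eq_zero_of_natDegree_lt (p := c) (n := m) (by omega)]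
      simp

lemma adj_der {p : ℂ[X]} (hp : p ≠ 0) (m : ℕ) (a : ℂ[X]) (h : mo m a ∈ WW p hp) (j n : ℕ) (hj : n + j = m) :
    ∃ c, mo n c ∈ WW p hp ∧ p ^ n * c = derivative^[j] (p ^ m * a) := by
  induction j generalizing n with
  | zero => exact ⟨a, by rw [← hj] at h; simpa using h, by simp [← hj]⟩
  | succ j ih =>
    obtain ⟨c, h1, h2⟩ := ih (n + 1) (by omega)
    have h3 := WW_br (WW_y p hp) h1
    rw [br_y_mo, Int.cast_natCast] at h3
    refine ⟨((n + 1 : ℕ) : ℂ) • (derivative p * c) + p * derivative c, ?_, ?_⟩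
    rotate_left
    · rw [Function.iterate_succ_apply', ← h2, ← pow_deriv]
    · convert h3 using 2
      push_cast; ring

lemma iter_lead (p a : ℂ[X]) (j n : ℕ) : ∃ (M : ℕ) (e : ℂ[X]), M ≠ 0 ∧
    derivative^[j] (p ^ (n + j) * a) = p ^ n * ((M : ℂ) • (derivative p ^ j * a) + p * e) := by
  induction j generalizing n with
  | zero => exact ⟨1, 0, one_ne_zero, by simp⟩
  | succ j ih =>
    obtain ⟨M, e, hM, h⟩ := ih (n + 1)
    refine ⟨(n + 1) * M, ((n + 1 : ℕ) : ℂ) • (derivative p * e) +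
      derivative ((M : ℂ) • (derivative p ^ j * a) + p * e), by positivity, ?_⟩
    rw [Function.iterate_succ_apply', show n + (j + 1) = n + 1 + j by ring, h, ← pow_deriv]
    congr 1
    simp only [smul_eq_C_mul]
    push_cast
    simp only [C_mul, C_add, C_1]
    ring

lemma z_mem_adjoin {p : ℂ[X]} (hp : p ≠ 0) (hsp : Squarefree p) (hp2 : 2 ≤ p.natDegree) :
    zK ∈ Algebra.adjoin ℂ (WW p hp : Set KK) := by
  set A := Algebra.adjoin ℂ (WW p hp : Set KK) with hA
  have hWA : ∀ u ∈ WW p hp, u ∈ A := fun u hu => Algebra.subset_adjoin hu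
  let Q : Subalgebra ℂ ℂ[X] := A.comap (aeval zK)
  have hQ : ∀ a, a ∈ Q ↔ aeval zK a ∈ A := fun a => Iff.rfl
  have hpQ : p ∈ Q := by
    rw [hQ]
    have := mul_mem (hWA _ (WW_x p hp 1)) (hWA _ (WW_y p hp))
    rw [pow_one, yK, mul_comm, mul_assoc, inv_mul_cancel₀ xK_ne, mul_one] at this
    exact this
  obtain ⟨N, hN⟩ := WW_S hp hp2 p.natDegree
  have h1 : ∀ (n j : ℕ) (a : ℂ[X]), N ≤ n + j → a.natDegree ≤ p.natDegree →
      derivative^[j] (p ^ (n + j) * a) ∈ Q := by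
    intro n j a hn ha
    obtain ⟨c, hc, e⟩ := adj_der hp (n + j) a (hN _ (by exact_mod_cast hn) _ ha) j n rfl
    rw [← e, hQ]
    have := mul_mem (pow_mem (hWA _ (WW_y p hp)) n) (hWA _ hc)
    rw [yK_mo, mo_pow, mo_mul] at this
    simpa [mo] using this
  have hmod : ∀ b : ℂ[X], (b % p).natDegree ≤ p.natDegree := by
    intro b
    exact natDegree_le_natDegree (degree_mod_lt b hp).le
  have h2 : ∀ b : ℂ[X], p ^ N * b ∈ Q := by
    intro b
    induction hd : b.natDegree using Nat.strong_induction_on generalizing b with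
    | _ k ih =>
      by_cases hb : b.natDegree ≤ p.natDegree
      · exact h1 N 0 b (by omega) hb
      · have hb0 : b ≠ 0 := by rintro rfl; simp at hb
        have e : p ^ N * b = p * (p ^ N * (b / p)) + p ^ N * (b % p) := by
          conv_lhs => rw [← EuclideanDomain.div_add_mod b p]
          ring
        rw [e]
        refine add_mem (mul_mem hpQ ?_) (h1 N 0 _ (by omega) (hmod b))
        by_cases h0 : b / p = 0
        · rw [h0, mul_zero]; exact zero_mem _
        refine ih _ ?_ (b / p) rfl
        rw [← hd]
        exact natDegree_lt_natDegree h0 (degree_div_lt hb0 (natDegree_pos_iff_degree_pos.1 (by omega)))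
  have h3 : ∀ n, (∀ b : ℂ[X], p ^ (n + 1) * b ∈ Q) → ∀ b : ℂ[X], p ^ n * b ∈ Q := by
    intro n hn b
    obtain ⟨u, v, huv⟩ := IsCoprime.pow_right (n := N) (coprime_deriv hsp)
    obtain ⟨M, e, hM, he⟩ := iter_lead p ((v * b) % p) N n
    have h4 := h1 n N _ (by omega) (hmod (v * b))
    rw [he] at h4
    have hdm := EuclideanDomain.div_add_mod (v * b) p
    have hM' : (M : ℂ) ≠ 0 := by exact_mod_cast hM
    have hCM : C (M : ℂ)⁻¹ * C (M : ℂ) = 1 := by rw [← C_mul, inv_mul_cancel₀ hM', C_1]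
    have h5 : p ^ n * b = (M : ℂ)⁻¹ • (p ^ n * ((M : ℂ) • (derivative p ^ N * (v * b % p)) + p * e)) +
        p ^ (n + 1) * (u * b + derivative p ^ N * (v * b / p) - C (M : ℂ)⁻¹ * e) := by
      simp only [smul_eq_C_mul]
      linear_combination (-(p ^ n * b)) * huv - p ^ n * derivative p ^ N * hdm
        - p ^ n * derivative p ^ N * (v * b % p) * hCM
    rw [h5]
    exact add_mem (Q.smul_mem h4 _) (hn _)
  have h4 : ∀ k ≤ N, ∀ b : ℂ[X], p ^ (N - k) * b ∈ Q := by
    intro k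
    induction k with
    | zero => intro _; exact h2
    | succ k ih =>
      intro hk
      apply h3
      rw [show N - (k + 1) + 1 = N - k by omega]
      exact ih (by omega)
  have h5 := h4 N le_rfl X
  simpa [hQ] using h5

lemma range_le_of_WW {p : ℂ[X]} (hp : p ≠ 0) (hsp : Squarefree p) (hp2 : 2 ≤ p.natDegree)
    {A : Type*} [CommRing A] [Algebra ℂ A] (ψ : ODan p →ₐ[ℂ] A) (S : Subalgebra ℂ A)
    (h : ∀ f, iota p f ∈ WW p hp → ψ f ∈ S) (f : ODan p) : ψ f ∈ S := by
  have key : ∀ u ∈ Algebra.adjoin ℂ (WW p hp : Set KK), ∃ f, iota p f = u ∧ ψ f ∈ S := by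
    intro u hu
    induction hu using Algebra.adjoin_induction with
    | mem u hu =>
      obtain ⟨f, rfl, hf⟩ := hu
      exact ⟨f, rfl, h f ⟨f, rfl, hf⟩⟩
    | algebraMap c => exact ⟨algebraMap ℂ _ c, AlgHom.commutes _ _, by
        rw [AlgHom.commutes]; exact S.algebraMap_mem c⟩
    | add u v _ _ hu hv =>
      obtain ⟨f, rfl, hf⟩ := hu
      obtain ⟨g, rfl, hg⟩ := hv
      exact ⟨f + g, map_add _ _ _, by rw [map_add]; exact add_mem hf hg⟩
    | mul u v _ _ hu hv =>
      obtain ⟨f, rfl, hf⟩ := hu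
      obtain ⟨g, rfl, hg⟩ := hv
      exact ⟨f * g, map_mul _ _ _, by rw [map_mul]; exact mul_mem hf hg⟩
  induction f using ODan_induction with
  | hC c => rw [AlgHom.commutes]; exact S.algebraMap_mem c
  | hx => exact h _ (by rw [iota_x]; simpa using WW_x p hp 1)
  | hy => exact h _ (by rw [iota_y]; exact WW_y p hp)
  | hz =>
    obtain ⟨f, hf, hS⟩ := key _ (z_mem_adjoin hp hsp hp2)
    rw [← iota_z p] at hf
    rw [← iota_inj hp hf]; exact hS
  | hadd a b ha hb => rw [map_add]; exact add_mem ha hb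
  | hmul a b ha hb => rw [map_mul]; exact mul_mem ha hb

/-! ### The relation induced by an isomorphism of Lie algebras -/

/-- Being constant. -/
def IsC (u : KK) : Prop := ∃ c : ℂ, u = algebraMap ℂ KK c

lemma IsC.zero : IsC 0 := ⟨0, by simp⟩
lemma IsC.cmul {u : KK} (h : IsC u) (c : ℂ) : IsC (algebraMap ℂ KK c * u) := by
  obtain ⟨d, rfl⟩ := h
  exact ⟨c * d, by rw [map_mul]⟩
lemma IsC.mulc {u v : KK} (h : IsC u) (h' : IsC v) : IsC (u * v) := by
  obtain ⟨d, rfl⟩ := h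
  obtain ⟨e, rfl⟩ := h'
  exact ⟨d * e, by rw [map_mul]⟩
lemma IsC.invc {u : KK} (h : IsC u) : IsC u⁻¹ := by
  obtain ⟨d, rfl⟩ := h
  exact ⟨d⁻¹, by rw [map_inv₀]⟩

lemma br_C_left (c : ℂ) (f g : KK) : br (algebraMap ℂ KK c * f) g = algebraMap ℂ KK c * br f g := by
  rw [← Algebra.smul_def, br_smul_left, Algebra.smul_def]
lemma br_C_right (c : ℂ) (f g : KK) : br f (algebraMap ℂ KK c * g) = algebraMap ℂ KK c * br f g := by
  rw [← Algebra.smul_def, br_smul_right, Algebra.smul_def]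

/-- Abstract properties of the correspondence between Hamiltonian functions. -/
structure RelData (p q : ℂ[X]) (hp : p ≠ 0) (hq : q ≠ 0) where
  R : KK → KK → Prop
  ex : ∀ {f}, f ∈ WW p hp → ∃ u, R f u
  ex' : ∀ {u}, u ∈ WW q hq → ∃ f, R f u
  memL : ∀ {f u}, R f u → f ∈ WW p hp
  memR : ∀ {f u}, R f u → u ∈ WW q hq
  add : ∀ {f u g v}, R f u → R g v → R (f + g) (u + v)
  smul : ∀ {f u} (c : ℂ), R f u → R (algebraMap ℂ KK c * f) (algebraMap ℂ KK c * u)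
  brk : ∀ {f u g v}, R f u → R g v → R (br f g) (br u v)
  uniq : ∀ {f u v}, R f u → R f v → IsC (u - v)
  cc : ∀ a b : ℂ, R (algebraMap ℂ KK a) (algebraMap ℂ KK b)
  const : ∀ {f u}, R f u → IsC u → IsC f

lemma iota_const' {p : ℂ[X]} (hp : p ≠ 0) {f g : ODan p} (h : ham p hp f = ham p hp g) :
    IsC (iota p f - iota p g) := by
  have h0 : ∀ k, br (iota p f - iota p g) (iota p k) = 0 := by
    intro k
    rw [br_sub_left, ← iota_ham p hp, ← iota_ham p hp, h, sub_self]
  have hz := h0 (zA p)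
  have hx := h0 (xA p)
  rw [iota_z] at hz
  rw [iota_x] at hx
  exact casimir hz hx

lemma iota_const {p : ℂ[X]} (hp : p ≠ 0) {f : ODan p} (h : ham p hp f = 0) : IsC (iota p f) := by
  have := iota_const' hp (h.trans (ham_zero p hp).symm)
  rwa [map_zero, sub_zero] at this

lemma ham_of_const {p : ℂ[X]} (hp : p ≠ 0) {f : ODan p} (h : IsC (iota p f)) : ham p hp f = 0 := by
  obtain ⟨c, hc⟩ := h
  rw [← AlgHom.commutes (iota p)] at hc
  rw [iota_inj hp hc, ham_const]

/-- The relation of an isomorphism. -/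
def relOf {p q : ℂ[X]} (hp : p ≠ 0) (hq : q ≠ 0) (F : lndSpan p ≃ₗ⁅ℂ⁆ lndSpan q) (f u : KK) : Prop :=
  ∃ (ff : ODan p) (uu : ODan q) (hf : ham p hp ff ∈ lndSpan p), iota p ff = f ∧ iota q uu = u ∧
    ((F ⟨ham p hp ff, hf⟩ : lndSpan q) : Derivation ℂ (ODan q) (ODan q)) = ham q hq uu

/-- The data of an isomorphism. -/
def relData {p q : ℂ[X]} (hp : p ≠ 0) (hq : q ≠ 0) (hsp : Squarefree p) (hsq : Squarefree q)
    (hp2 : 2 ≤ p.natDegree) (hq2 : 2 ≤ q.natDegree) (F : lndSpan p ≃ₗ⁅ℂ⁆ lndSpan q) :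
    RelData p q hp hq where
  R := relOf hp hq F
  ex := by
    rintro _ ⟨f, rfl, hf⟩
    obtain ⟨u, hu⟩ := span_isHam hsq hq2 hq (F ⟨ham p hp f, hf⟩).2
    exact ⟨iota q u, f, u, hf, rfl, rfl, hu⟩
  ex' := by
    rintro _ ⟨u, rfl, hu⟩
    obtain ⟨f, hf⟩ := span_isHam hsp hp2 hp (F.symm ⟨ham q hq u, hu⟩).2
    have hf' : ham p hp f ∈ lndSpan p := by rw [← hf]; exact (F.symm ⟨ham q hq u, hu⟩).2
    refine ⟨iota p f, f, u, hf', rfl, rfl, ?_⟩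
    have : (⟨ham p hp f, hf'⟩ : lndSpan p) = F.symm ⟨ham q hq u, hu⟩ := Subtype.ext hf.symm
    rw [this, LieEquiv.apply_symm_apply]
  memL := by
    rintro _ _ ⟨f, u, hf, rfl, rfl, h⟩
    exact ⟨f, rfl, hf⟩
  memR := by
    rintro _ _ ⟨f, u, hf, rfl, rfl, h⟩
    exact ⟨u, rfl, by rw [← h]; exact (F ⟨ham p hp f, hf⟩).2⟩
  add := by
    rintro _ _ _ _ ⟨f, u, hf, rfl, rfl, h⟩ ⟨g, v, hg, rfl, rfl, h'⟩
    have hm : ham p hp (f + g) ∈ lndSpan p := by rw [ham_add]; exact add_mem hf hg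
    refine ⟨f + g, u + v, hm, map_add _ _ _, map_add _ _ _, ?_⟩
    have : (⟨ham p hp (f + g), hm⟩ : lndSpan p) = ⟨ham p hp f, hf⟩ + ⟨ham p hp g, hg⟩ :=
      Subtype.ext (ham_add p hp f g)
    rw [this, map_add, ham_add, ← h, ← h']; rfl
  smul := by
    rintro _ _ c ⟨f, u, hf, rfl, rfl, h⟩
    have hm : ham p hp (c • f) ∈ lndSpan p := by rw [ham_smul]; exact (lndSpan p).smul_mem c hf
    refine ⟨c • f, c • u, hm, by rw [map_smul, Algebra.smul_def], by rw [map_smul, Algebra.smul_def], ?_⟩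
    have : (⟨ham p hp (c • f), hm⟩ : lndSpan p) = c • ⟨ham p hp f, hf⟩ :=
      Subtype.ext (ham_smul p hp c f)
    rw [this, map_smul, ham_smul, ← h]; rfl
  brk := by
    rintro _ _ _ _ ⟨f, u, hf, rfl, rfl, h⟩ ⟨g, v, hg, rfl, rfl, h'⟩
    have hm : ham p hp (pb p f g) ∈ lndSpan p := by rw [← ham_lie]; exact (lndSpan p).lie_mem hf hg
    refine ⟨pb p f g, pb q u v, hm, iota_pb _ _ _, iota_pb _ _ _, ?_⟩
    have : (⟨ham p hp (pb p f g), hm⟩ : lndSpan p) = ⁅(⟨ham p hp f, hf⟩ : lndSpan p), ⟨ham p hp g, hg⟩⁆ :=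
      Subtype.ext (ham_lie p hp f g).symm
    rw [this, LieEquiv.map_lie, ← ham_lie, ← h, ← h']; rfl
  uniq := by
    rintro _ _ _ ⟨f, u, hf, rfl, rfl, h⟩ ⟨g, v, hg, e, rfl, h'⟩
    obtain rfl := iota_inj hp e
    exact iota_const' hq (h.symm.trans h')
  cc := by
    intro a b
    have hm : ham p hp (algebraMap ℂ _ a) ∈ lndSpan p := by rw [ham_const]; exact zero_mem _
    refine ⟨algebraMap ℂ _ a, algebraMap ℂ _ b, hm, AlgHom.commutes _ _, AlgHom.commutes _ _, ?_⟩
    have : (⟨ham p hp (algebraMap ℂ _ a), hm⟩ : lndSpan p) = 0 := Subtype.ext (ham_const p hp a)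
    rw [this, map_zero, ham_const]; rfl
  const := by
    rintro _ _ ⟨f, u, hf, rfl, rfl, h⟩ hc
    rw [ham_of_const hq hc] at h
    have h1 : F ⟨ham p hp f, hf⟩ = 0 := Subtype.ext h
    have h2 : (⟨ham p hp f, hf⟩ : lndSpan p) = 0 := by
      apply F.injective
      exact h1.trans (map_zero F).symm
    exact iota_const hp (congrArg Subtype.val h2)

namespace RelData

variable {p q : ℂ[X]} {hp : p ≠ 0} {hq : q ≠ 0} (D : RelData p q hp hq)

lemma shift {f u v : KK} (h : D.R f u) (hc : IsC (v - u)) : D.R f v := by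
  obtain ⟨c, hc⟩ := hc
  have := D.add h (D.cc 0 c)
  rwa [map_zero, add_zero, ← hc, add_sub_cancel] at this

lemma brNN {f u g v : KK} (h : D.R f u) (h' : D.R g v) : br u v ∈ NN q := by
  obtain ⟨a, rfl, -⟩ := D.memR h
  obtain ⟨b, rfl, -⟩ := D.memR h'
  exact br_mem_NN q a b

/-- Canonical lifts. -/
def L (f u : KK) : Prop := D.R f u ∧ u ∈ NN q

lemma Lbr {f u g v : KK} (h : D.R f u) (h' : D.R g v) : D.L (br f g) (br u v) :=
  ⟨D.brk h h', D.brNN h h'⟩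

lemma Lsmul {f u : KK} (c : ℂ) (h : D.L f u) : D.L (algebraMap ℂ KK c * f) (algebraMap ℂ KK c * u) :=
  ⟨D.smul c h.1, by rw [← Algebra.smul_def]; exact (NN q).smul_mem c h.2⟩

lemma Luniq (hq2 : 2 ≤ q.natDegree) {f u v : KK} (h : D.L f u) (h' : D.L f v) : u = v := by
  obtain ⟨c, hc⟩ := D.uniq h.1 h'.1
  have : algebraMap ℂ KK c ∈ NN q := by rw [← hc]; exact sub_mem h.2 h'.2
  rw [NN_const hq2 this, map_zero] at hc
  exact sub_eq_zero.1 hc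

lemma L0 : D.L 0 0 := ⟨by simpa using D.cc 0 0, zero_mem _⟩

end RelData

lemma KK_char : CharZero KK := charZero_of_injective_algebraMap (algebraMap ℂ KK).injective

lemma br_xpow_mo (a : ℂ[X]) (j : ℕ) (i : ℤ) : br (xK ^ j) (mo i a) = (j : KK) * mo (j + i) (- derivative a) := by
  rw [← mo_natone, br_mo]
  have : (j : KK) = algebraMap ℂ KK j := by simp
  rw [this, ← Algebra.smul_def, ← mo_smul]
  congr 1
  simp

lemma xpp_not_const {p : ℂ[X]} (hp2 : 2 ≤ p.natDegree) : ¬ IsC (br xK (br xK (yK p))) := by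
  rw [yK_mo, br_x_mo, br_x_mo]
  rintro ⟨c, hc⟩
  have := mo_const (by norm_num) hc
  have h2 : (derivative (derivative p)).natDegree = p.natDegree - 1 - 1 := by
    rw [natDegree_derivative, natDegree_derivative]
  have h3 : derivative (derivative p) = 0 := by simpa using this
  -- the second derivative vanishes only in degree at most one
  have h4 : (derivative p).natDegree = 0 := derivative_eq_zero.1 h3
  rw [natDegree_derivative] at h4
  omega

lemma x_not_const (i : ℕ) : ¬ IsC (xK ^ (i + 1)) := by
  rintro ⟨c, hc⟩
  rw [← mo_natone] at hc
  exact one_ne_zero (mo_const (by omega) hc)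

namespace RelData

variable {p q : ℂ[X]} {hp : p ≠ 0} {hq : q ≠ 0} (D : RelData p q hp hq)

lemma stepAB (hp2 : 2 ≤ p.natDegree) (hq2 : 2 ≤ q.natDegree) {g : KK} (hg : D.R xK g) :
    ∃ t f : KK, br g f ≠ 0 ∧
      ∀ (i : ℕ) (u : KK), D.R (xK ^ (i + 1)) u → ∀ h, br u h = (i + 1) * t ^ i * br g h := by
  have := KK_char
  obtain ⟨f, hf⟩ := D.ex (WW_y p hp)
  have hE : br g (br g f) ≠ 0 := by
    intro h0
    exact xpp_not_const hp2 (D.const (D.brk hg (D.brk hg hf)) (by rw [h0]; exact IsC.zero))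
  have hgf : br g f ≠ 0 := by
    intro h0
    rw [h0, br_zero_right] at hE
    exact hE rfl
  have h1 : ∀ (i : ℕ) (u : KK), D.R (xK ^ (i + 1)) u → br u g = 0 := by
    intro i u hu
    have h := D.Lbr hu hg
    rw [br_pow_left, br_self, mul_zero] at h
    exact D.Luniq hq2 h D.L0
  have h2 : ∀ (i : ℕ) (u : KK), D.R (xK ^ (i + 1)) u → ∀ h, br u h = br u f / br g f * br g h := by
    intro i u hu h
    have e := br_plucker u g h f
    rw [h1 i u hu, zero_mul, add_zero] at e
    field_simp
    exact e
  have h3 : ∀ (i : ℕ) (u : KK), D.R (xK ^ (i + 1)) u → br g (br u f / br g f) = 0 := by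
    intro i u hu
    have e1 : br g (br u f) = br u (br g f) := by
      rw [br_jacobi g u f, br_swap g u, h1 i u hu, neg_zero, br_zero_left, zero_add]
    have e2 : br u f = br u f / br g f * br g f := by field_simp
    rw [h2 i u hu (br g f)] at e1
    conv_lhs at e1 => rw [e2]
    rw [br_mul_right] at e1
    have e3 : br g f * br g (br u f / br g f) = 0 := by linear_combination e1
    exact (mul_eq_zero.1 e3).resolve_left hgf
  obtain ⟨w, hw⟩ := D.ex (WW_x p hp 2)
  have key : ∀ (i : ℕ) (u : KK), D.R (xK ^ (i + 1)) u →
      br u f / br g f = (i + 1) * (br w f / br g f / 2) ^ i := by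
    intro i
    induction i with
    | zero =>
      intro u hu
      have hu' : D.R xK u := by simpa using hu
      have e := D.Luniq hq2 (D.Lbr hu' (D.brk hg hf)) (D.Lbr hg (D.brk hg hf))
      rw [h2 0 u hu (br g f)] at e
      have : br u f / br g f = 1 := by
        apply mul_right_cancel₀ hE
        rw [e, one_mul]
      rw [this]; simp
    | succ i ih =>
      intro u hu
      obtain ⟨u', hu'⟩ := D.ex (WW_x p hp (i + 1))
      have i1 := ih u' hu'
      have l1 := D.Lbr hu (D.brk hg hf)
      have l2 := D.Lbr hu' (D.brk hw hf)
      set m := mo ((i : ℤ) + 2) (derivative (derivative p)) with hm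
      have e0 : - derivative (- derivative p) = derivative (derivative p) := by
        rw [derivative_neg, neg_neg]
      have e1 : br (xK ^ (i + 1 + 1)) (br xK (yK p)) = algebraMap ℂ KK ((i + 2 : ℕ) : ℂ) * m := by
        rw [yK_mo, br_x_mo, br_xpow_mo, hm, e0, map_natCast,
          show (((i + 1 + 1 : ℕ) : ℤ) + (-1 + 1)) = (i : ℤ) + 2 by push_cast; ring]
      have e2 : br (xK ^ (i + 1)) (br (xK ^ 2) (yK p)) = algebraMap ℂ KK ((2 * (i + 1) : ℕ) : ℂ) * m := by
        rw [yK_mo, br_xpow_mo, ← map_natCast (algebraMap ℂ KK) 2, br_C_right, br_xpow_mo, e0, hm,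
          show (((i + 1 : ℕ) : ℤ) + (((2 : ℕ) : ℤ) + -1)) = (i : ℤ) + 2 by push_cast; ring,
          Nat.cast_mul, map_mul, mul_assoc, map_natCast, map_natCast]
      rw [e1, h2 (i + 1) u hu (br g f)] at l1
      have e4 : br w f = br w f / br g f * br g f := by field_simp
      have e5 : br u' (br w f) = br u' f / br g f * (br w f / br g f) * br g (br g f) := by
        rw [h2 i u' hu']
        conv_lhs => rw [e4]
        rw [br_mul_right, h3 1 w hw]
        ring
      rw [e2, e5] at l2
      have l1' := D.Lsmul ((2 * (i + 1) : ℕ) : ℂ) l1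
      have l2' := D.Lsmul ((i + 2 : ℕ) : ℂ) l2
      rw [mul_left_comm] at l2'
      have e6 := D.Luniq hq2 l1' l2'
      simp only [map_natCast] at e6
      push_cast at e6
      rw [i1] at e6
      have e7 : (2 * ((i : KK) + 1)) * (br u f / br g f) =
          (i + 2) * ((i + 1) * (br w f / br g f / 2) ^ i * (br w f / br g f)) := by
        apply mul_right_cancel₀ hE
        linear_combination e6
      have hi : (i : KK) + 1 ≠ 0 := by exact_mod_cast Nat.succ_ne_zero i
      apply mul_left_cancel₀ (mul_ne_zero two_ne_zero hi)
      rw [e7, pow_succ]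
      push_cast
      ring
  refine ⟨br w f / br g f / 2, f, hgf, ?_⟩
  intro i u hu h
  rw [h2 i u hu, key i u hu]

end RelData

namespace RelData

variable {p q : ℂ[X]} {hp : p ≠ 0} {hq : q ≠ 0} (D : RelData p q hp hq)

lemma stepC (hp2 : 2 ≤ p.natDegree) (hq2 : 2 ≤ q.natDegree) :
    ∃ (s : KK) (α : ℂ), α ≠ 0 ∧ ¬ IsC s ∧ ∀ i : ℕ, D.R (xK ^ i) (algebraMap ℂ KK α * s ^ i) := by
  have := KK_char
  obtain ⟨g, hg⟩ := D.ex (f := xK) (by simpa using WW_x p hp 1)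
  obtain ⟨t, f, hgf, hAB⟩ := D.stepAB hp2 hq2 hg
  obtain ⟨N, hN⟩ := WW_S hp hp2 1
  obtain ⟨e, he⟩ := D.ex (hN N le_rfl X (by simp))
  set v := br e g with hv
  have hk : ∀ k : ℕ, D.R (xK ^ (N + k + 1)) (t ^ k * v) := by
    intro k
    obtain ⟨u, hu⟩ := D.ex (WW_x p hp (k + 1))
    have h1 := D.brk he hu
    have hk0 : ((k + 1 : ℕ) : ℂ) ≠ 0 := by exact_mod_cast Nat.succ_ne_zero k
    have h2 : br (mo N X) (xK ^ (k + 1)) = algebraMap ℂ KK ((k + 1 : ℕ) : ℂ) * xK ^ (N + k + 1) := by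
      rw [br_swap, br_xpow_mo, derivative_X, map_natCast, ← mo_natone]
      rw [show ((k + 1 : ℕ) : ℤ) + N = ((N + k + 1 : ℕ) : ℤ) by push_cast; ring]
      simp only [mo, map_neg]; ring
    have h3 : br e u = algebraMap ℂ KK ((k + 1 : ℕ) : ℂ) * (t ^ k * v) := by
      rw [br_swap, hAB k u hu, hv, br_swap e g, map_natCast]
      push_cast; ring
    rw [h2, h3] at h1
    have h4 := D.smul (((k + 1 : ℕ) : ℂ)⁻¹) h1
    rwa [← mul_assoc, ← mul_assoc, ← map_mul, inv_mul_cancel₀ hk0, map_one, one_mul, one_mul] at h4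
  have hv0 : v ≠ 0 := by
    intro h0
    have h1 := hk 0
    rw [h0, mul_zero] at h1
    exact x_not_const _ (D.const h1 IsC.zero)
  have ht0 : t ≠ 0 := by
    intro h0
    have h1 := hk 1
    rw [h0, pow_one, zero_mul] at h1
    exact x_not_const _ (D.const h1 IsC.zero)
  have b0 : ∀ h, br v h = (N + 1) * t ^ N * br g h := by
    intro h
    have := hAB (N + 0) _ (hk 0) h
    simpa using this
  have b1 : ∀ h, v * br t h = t ^ (N + 1) * br g h := by
    intro h
    have h1 := hAB (N + 1) _ (hk 1) h
    rw [pow_one, br_mul_left, b0 h] at h1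
    push_cast at h1
    linear_combination h1
  set κ := t ^ (N + 1) / v with hκ
  have hκ0 : κ ≠ 0 := div_ne_zero (pow_ne_zero _ ht0) hv0
  have hκv : κ * v = t ^ (N + 1) := by rw [hκ]; field_simp
  have bt : ∀ h, br t h = κ * br g h := by
    intro h
    apply mul_left_cancel₀ hv0
    rw [b1 h]
    linear_combination (- br g h) * hκv
  have bκ : ∀ h, br κ h = 0 := by
    intro h
    have h1 := congrArg (fun w => br w h) hκv
    beta_reduce at h1
    rw [br_mul_left, br_pow_left, b0 h, bt h] at h1
    apply mul_left_cancel₀ hv0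
    linear_combination h1
  obtain ⟨k, hk'⟩ := casimir' bκ
  have hk0 : k ≠ 0 := by rintro rfl; rw [hk', map_zero] at hκ0; exact hκ0 rfl
  have hinv : algebraMap ℂ KK k⁻¹ * κ = 1 := by rw [hk', ← map_mul, inv_mul_cancel₀ hk0, map_one]
  have hpow : ∀ i : ℕ, D.R (xK ^ (i + 1)) (algebraMap ℂ KK k⁻¹ * t ^ (i + 1)) := by
    intro i
    obtain ⟨u, hu⟩ := D.ex (WW_x p hp (i + 1))
    refine D.shift hu (casimir' fun h => ?_)
    rw [br_sub_left, br_C_left, br_pow_left, hAB i u hu, bt]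
    linear_combination (((i : KK) + 1) * t ^ i * br g h) * hinv
  refine ⟨t, k⁻¹, inv_ne_zero hk0, ?_, ?_⟩
  · intro hc
    have h1 := hpow 0
    refine x_not_const 0 (D.const h1 ?_)
    rw [zero_add, pow_one]
    exact hc.cmul _
  · intro i
    rcases i with _ | i
    · simpa using D.cc 1 k⁻¹
    · exact hpow i

end RelData

lemma constpow {s B : KK} (hs : ¬ IsC s) (N : ℕ) (h : ∀ i, N ≤ i → IsC (s ^ i * B)) : B = 0 := by
  by_contra hB
  have hs0 : s ≠ 0 := by rintro rfl; exact hs IsC.zero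
  have h1 := h N le_rfl
  have h2 := h (N + 1) (by omega)
  apply hs
  have := h2.mulc h1.invc
  have e : s ^ (N + 1) * B * (s ^ N * B)⁻¹ = s := by
    rw [pow_succ]; field_simp
  rwa [e] at this

lemma br_pow_left' {s : KK} (hs : s ≠ 0) (i : ℕ) (h : KK) : br (s ^ i) h = i * s ^ i * (s⁻¹ * br s h) := by
  rcases i with _ | i
  · have := br_const_left h 1
    rw [map_one] at this
    simpa using this
  · rw [br_pow_left, pow_succ]; push_cast; field_simp

lemma br_pow_right' {s : KK} (hs : s ≠ 0) (i : ℕ) (h : KK) : br h (s ^ i) = i * s ^ i * (s⁻¹ * br h s) := by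
  rw [br_swap, br_pow_left' hs, br_swap s h]; ring

namespace RelData

variable {p q : ℂ[X]} {hp : p ≠ 0} {hq : q ≠ 0} (D : RelData p q hp hq)

lemma stepE1 (hp2 : 2 ≤ p.natDegree) (hq2 : 2 ≤ q.natDegree) {s : KK} {α : ℂ} (hα : α ≠ 0)
    (hs : ¬ IsC s) (hx : ∀ i : ℕ, D.R (xK ^ i) (algebraMap ℂ KK α * s ^ i)) (k : ℕ) :
    ∃ (N : ℕ) (Z : KK), ∀ i : ℕ, N ≤ i → D.R (mo i (X ^ k)) (algebraMap ℂ KK α * s ^ i * Z) := by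
  have := KK_char
  have hs0 : s ≠ 0 := by rintro rfl; exact hs IsC.zero
  have hα0 : algebraMap ℂ KK α ≠ 0 := by simpa using hα
  obtain ⟨N, hN⟩ := WW_S hp hp2 (k + 1)
  obtain ⟨u, hu⟩ := D.ex (hN N le_rfl (X ^ (k + 1)) (natDegree_X_pow_le _))
  refine ⟨N + 1, - (algebraMap ℂ KK ((k + 1 : ℕ) : ℂ)⁻¹ * (s⁻¹ * br s u / s ^ N)), ?_⟩
  intro i hi
  obtain ⟨j, rfl⟩ := Nat.exists_eq_add_of_le hi
  have hk0 : ((k + 1 : ℕ) : ℂ) ≠ 0 := by exact_mod_cast Nat.succ_ne_zero k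
  have hj0 : ((j + 1 : ℕ) : ℂ) ≠ 0 := by exact_mod_cast Nat.succ_ne_zero j
  have h1 := D.smul (-(((k + 1 : ℕ) : ℂ)⁻¹ * ((j + 1 : ℕ) : ℂ)⁻¹)) (D.brk (hx (j + 1)) hu)
  have e1 : mo ((N + 1 + j : ℕ) : ℤ) (X ^ k) =
      algebraMap ℂ KK (-(((k + 1 : ℕ) : ℂ)⁻¹ * ((j + 1 : ℕ) : ℂ)⁻¹)) * br (xK ^ (j + 1)) (mo N (X ^ (k + 1))) := by
    rw [br_xpow_mo, derivative_X_pow, ← map_natCast (algebraMap ℂ KK), ← mul_assoc, ← map_mul,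
      ← Algebra.smul_def, ← mo_smul]
    congr 1
    · push_cast; ring
    · rw [← smul_eq_C_mul, ← smul_neg, smul_smul, smul_neg, ← neg_smul, Nat.add_sub_cancel]
      have : -(-(((k + 1 : ℕ) : ℂ)⁻¹ * ((j + 1 : ℕ) : ℂ)⁻¹) * ((j + 1 : ℕ) : ℂ) * ((k + 1 : ℕ) : ℂ)) = 1 := by
        field_simp
      rw [this, one_smul]
  rw [e1]
  convert h1 using 1
  rw [br_C_left, br_pow_left' hs0]
  simp only [map_neg, map_mul, map_inv₀, map_natCast]
  have hj1 : ((j + 1 : ℕ) : KK) ≠ 0 := by exact_mod_cast Nat.succ_ne_zero j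
  have hk1 : ((k + 1 : ℕ) : KK) ≠ 0 := by exact_mod_cast Nat.succ_ne_zero k
  field_simp
  ring


lemma stepE2 (hp2 : 2 ≤ p.natDegree) (hq2 : 2 ≤ q.natDegree) {s : KK} {α : ℂ} (hα : α ≠ 0)
    (hs : ¬ IsC s) (hx : ∀ i : ℕ, D.R (xK ^ i) (algebraMap ℂ KK α * s ^ i)) :
    ∃ ζ : KK, algebraMap ℂ KK α * br ζ s = s ∧ ∀ k : ℕ, ∃ N : ℕ, ∀ i : ℕ, N ≤ i →
      D.R (mo i (X ^ k)) (algebraMap ℂ KK α * s ^ i * ζ ^ k) := by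
  have := KK_char
  have hs0 : s ≠ 0 := by rintro rfl; exact hs IsC.zero
  set a := algebraMap ℂ KK α with ha
  have ha0 : a ≠ 0 := by rw [ha]; simpa using hα
  have hbl : ∀ f g, br (a * f) g = a * br f g := br_C_left α
  have hbr : ∀ f g, br f (a * g) = a * br f g := br_C_right α
  -- first relation
  have first : ∀ (k N M : ℕ) (Z W : KK),
      (∀ i : ℕ, N ≤ i → D.R (mo i (X ^ (k + 1))) (a * s ^ i * Z)) →
      (∀ i : ℕ, M ≤ i → D.R (mo i (X ^ k)) (a * s ^ i * W)) → a * br Z s = (k + 1) * s * W := by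
    intro k N M Z W h1 h2
    have hk : a * br Z s - (k + 1) * s * W = 0 := by
      refine (mul_eq_zero.1 (constpow (B := a * (a * br Z s - (k + 1) * s * W)) hs (N + M)
        fun i hi => ?_)).resolve_left ha0
      have r1 := D.brk (h1 i (by omega)) (hx 1)
      have r2 := D.smul ((k + 1 : ℕ) : ℂ) (h2 (i + 1) (by omega))
      have e : br (mo i (X ^ (k + 1))) (xK ^ 1) = algebraMap ℂ KK ((k + 1 : ℕ) : ℂ) * mo ((i + 1 : ℕ) : ℤ) (X ^ k) := by
        rw [br_swap, pow_one, br_x_mo, derivative_X_pow, ← Algebra.smul_def, ← mo_smul]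
        have : ∀ (i : ℤ) (b : ℂ[X]), - mo i b = mo i (-b) := by
          intro i b; simp [mo]
        rw [this, neg_neg, ← smul_eq_C_mul, Nat.add_sub_cancel]
        push_cast
        rfl
      rw [e] at r1
      have := D.uniq r1 r2
      convert this using 1
      rw [mul_assoc a (s ^ i) Z, hbl, pow_one, hbr, br_mul_left, br_pow_left' hs0, br_self, map_natCast]
      push_cast
      ring
    linear_combination hk
  -- degree zero
  have zero : ∀ i : ℕ, 0 ≤ i → D.R (mo i (X ^ 0)) (a * s ^ i * 1) := by
    intro i _
    rw [pow_zero, mo_natone, mul_one]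
    exact hx i
  obtain ⟨N1, ζ, hζ⟩ := D.stepE1 hp2 hq2 hα hs hx 1
  have hζs : a * br ζ s = s := by
    have := first 0 N1 0 ζ 1 hζ zero
    simpa using this
  refine ⟨ζ, hζs, fun k => ?_⟩
  induction k with
  | zero =>
    exact ⟨0, fun i hi => by simpa using zero i hi⟩
  | succ k ih =>
    obtain ⟨M, hM⟩ := ih
    obtain ⟨N, Z, hZ⟩ := D.stepE1 hp2 hq2 hα hs hx (k + 1)
    have f1 := first k N M Z (ζ ^ k) hZ hM
    have second : ∀ j : ℕ, N1 ≤ j → a * br Z ζ = (j : KK) * (k + 1) * (Z - ζ ^ (k + 1)) := by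
      intro j hj
      have hk : a * br Z ζ - (j : KK) * (k + 1) * (Z - ζ ^ (k + 1)) = 0 := by
        refine (mul_eq_zero.1 (constpow (B := a * s ^ j * (a * br Z ζ - (j : KK) * (k + 1) * (Z - ζ ^ (k + 1))))
          hs N fun i hi => ?_)).resolve_left (mul_ne_zero ha0 (pow_ne_zero _ hs0))
        have r1 := D.brk (hZ i hi) (hζ j hj)
        have r2 := D.smul ((j : ℂ) * (k + 1 : ℕ) - i) (hZ (i + j) (by omega))
        have e : br (mo i (X ^ (k + 1))) (mo j (X ^ 1)) =
            algebraMap ℂ KK ((j : ℂ) * (k + 1 : ℕ) - i) * mo ((i + j : ℕ) : ℤ) (X ^ (k + 1)) := by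
          rw [br_mo, ← Algebra.smul_def, ← mo_smul, derivative_X_pow, pow_one, derivative_X]
          congr 1
          rw [sub_smul, ← smul_smul, Nat.add_sub_cancel, ← smul_eq_C_mul, smul_mul_assoc, ← pow_succ, mul_one]
          simp
        rw [e] at r1
        have := D.uniq r1 r2
        convert this using 1
        rw [mul_assoc a (s ^ i) Z, hbl, mul_assoc a (s ^ j) ζ, hbr, br_mul_left, br_mul_right, br_mul_right, br_pow_left' hs0,
          br_pow_left' hs0, br_pow_right' hs0, br_pow_right' hs0, br_self, br_swap s ζ, ← ha]
        simp only [map_sub, map_mul, map_natCast]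
        have e1 : s⁻¹ * (a * br ζ s) = 1 := by rw [hζs, inv_mul_cancel₀ hs0]
        have e2 : s⁻¹ * (a * br Z s) = (k + 1) * ζ ^ k := by rw [f1]; field_simp
        push_cast
        rw [pow_add]
        linear_combination (a * s ^ i * s ^ j * Z * i) * e1 - (a * s ^ i * s ^ j * ζ * j) * e2
      linear_combination hk
    have s1 := second N1 le_rfl
    have s2 := second (N1 + 1) (by omega)
    rw [s1] at s2
    push_cast at s2
    have hk1 : ((k : KK) + 1) ≠ 0 := by exact_mod_cast Nat.succ_ne_zero k
    have e : ((k : KK) + 1) * (Z - ζ ^ (k + 1)) = 0 := by linear_combination -s2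
    have e' := sub_eq_zero.1 ((mul_eq_zero.1 e).resolve_left hk1)
    exact ⟨N, fun i hi => by rw [← e']; exact hZ i hi⟩

end RelData

/-! ### The induced homomorphism -/

/-- The homomorphism on polynomials. -/
def phiP (p : ℂ[X]) (s ζ : KK) : P3 →ₐ[ℂ] KK := MvPolynomial.aeval ![s, aeval ζ p * s⁻¹, ζ]

lemma phiP_x (p : ℂ[X]) (s ζ : KK) : phiP p s ζ xP = s := by simp [phiP, xP]
lemma phiP_y (p : ℂ[X]) (s ζ : KK) : phiP p s ζ yP = aeval ζ p * s⁻¹ := by simp [phiP, yP]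
lemma phiP_z (p : ℂ[X]) (s ζ : KK) : phiP p s ζ zP = ζ := by simp [phiP, zP]

/-- The homomorphism from the coordinate ring sending `x, z` to `s, ζ`. -/
def phi (p : ℂ[X]) (s ζ : KK) (hs : s ≠ 0) : ODan p →ₐ[ℂ] KK :=
  Ideal.Quotient.liftₐ (relIdeal p) (phiP p s ζ) (by
    intro a ha
    have : relIdeal p ≤ RingHom.ker (phiP p s ζ) := by
      rw [relIdeal, Ideal.span_le, Set.singleton_subset_iff]
      change phiP p s ζ _ = 0
      rw [map_sub, map_mul, phiP_x, phiP_y, ← Polynomial.aeval_algHom_apply, phiP_z]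
      field_simp [hs]
      ring
    exact this ha)

lemma phi_x (p : ℂ[X]) (s ζ : KK) (hs : s ≠ 0) : phi p s ζ hs (xA p) = s := phiP_x p s ζ
lemma phi_z (p : ℂ[X]) (s ζ : KK) (hs : s ≠ 0) : phi p s ζ hs (zA p) = ζ := phiP_z p s ζ
lemma phi_zc (p : ℂ[X]) (s ζ : KK) (hs : s ≠ 0) (c : ℂ[X]) :
    phi p s ζ hs (aeval (zA p) c) = aeval ζ c := by
  rw [← Polynomial.aeval_algHom_apply, phi_z]

lemma pb_add_left {p : ℂ[X]} (hp : p ≠ 0) (f g h : ODan p) : pb p (f + g) h = pb p f h + pb p g h := by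
  apply iota_inj hp; simp only [map_add, iota_pb, br_add_left]
lemma pb_mul_left {p : ℂ[X]} (hp : p ≠ 0) (f g h : ODan p) :
    pb p (f * g) h = f * pb p g h + g * pb p f h := by
  apply iota_inj hp; simp only [map_add, map_mul, iota_pb, br_mul_left]
lemma pb_const_left {p : ℂ[X]} (hp : p ≠ 0) (c : ℂ) (h : ODan p) :
    pb p (algebraMap ℂ _ c) h = 0 := by
  apply iota_inj hp; rw [iota_pb, AlgHom.commutes, br_const_left, map_zero]

/-- If a homomorphism is Poisson against `g` on `x` and `z`, it is so on everything. -/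
lemma poisson_gen {p : ℂ[X]} (hp : p ≠ 0) (φ : ODan p →ₐ[ℂ] KK) (a : KK) (hx0 : φ (xA p) ≠ 0)
    (g : ODan p) (hx : φ (pb p (xA p) g) = a * br (φ (xA p)) (φ g))
    (hz : φ (pb p (zA p) g) = a * br (φ (zA p)) (φ g)) (f : ODan p) :
    φ (pb p f g) = a * br (φ f) (φ g) := by
  have hC : ∀ c : ℂ, φ (pb p (algebraMap ℂ _ c) g) = a * br (φ (algebraMap ℂ _ c)) (φ g) := by
    intro c
    rw [pb_const_left hp, AlgHom.commutes, br_const_left, map_zero, mul_zero]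
  have hadd : ∀ f h, φ (pb p f g) = a * br (φ f) (φ g) → φ (pb p h g) = a * br (φ h) (φ g) →
      φ (pb p (f + h) g) = a * br (φ (f + h)) (φ g) := by
    intro f h h1 h2
    rw [pb_add_left hp, map_add, map_add, br_add_left, h1, h2]; ring
  have hmul : ∀ f h, φ (pb p f g) = a * br (φ f) (φ g) → φ (pb p h g) = a * br (φ h) (φ g) →
      φ (pb p (f * h) g) = a * br (φ (f * h)) (φ g) := by
    intro f h h1 h2
    rw [pb_mul_left hp, map_add, map_mul, map_mul, map_mul, br_mul_left, h1, h2]; ring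
  have hpz : ∀ c : ℂ[X], φ (pb p (aeval (zA p) c) g) = a * br (φ (aeval (zA p) c)) (φ g) := by
    intro c
    induction c using Polynomial.induction_on' with
    | add c d h1 h2 => rw [map_add]; exact hadd _ _ h1 h2
    | monomial n b =>
      rw [aeval_monomial]
      refine hmul _ _ (hC b) ?_
      induction n with
      | zero => rw [pow_zero]; simpa using hC 1
      | succ n ih => rw [pow_succ]; exact hmul _ _ ih hz
  refine ODan_induction hC hx ?_ hz hadd hmul f
  have h1 := hpz p
  rw [← xA_mul_yA, pb_mul_left hp, map_add, map_mul, map_mul, map_mul, br_mul_left, hx] at h1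
  apply mul_left_cancel₀ hx0
  linear_combination h1

lemma poisson_all {p : ℂ[X]} (hp : p ≠ 0) (φ : ODan p →ₐ[ℂ] KK) (a : KK) (hx0 : φ (xA p) ≠ 0)
    (h : a * br (φ (zA p)) (φ (xA p)) = φ (xA p)) (f g : ODan p) :
    φ (pb p f g) = a * br (φ f) (φ g) := by
  have self : ∀ f : ODan p, φ (pb p f f) = a * br (φ f) (φ f) := by
    intro f
    have : pb p f f = 0 := by apply iota_inj hp; rw [iota_pb, br_self, map_zero]
    rw [this, br_self, map_zero, mul_zero]
  have sw : ∀ f g : ODan p, φ (pb p f g) = a * br (φ f) (φ g) → φ (pb p g f) = a * br (φ g) (φ f) := by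
    intro f g h1
    rw [pb_swap hp, map_neg, h1, br_swap (φ g)]; ring
  have zx : φ (pb p (zA p) (xA p)) = a * br (φ (zA p)) (φ (xA p)) := by
    have : pb p (zA p) (xA p) = xA p := by
      apply iota_inj hp; rw [iota_pb, iota_z, iota_x, br_zx]
    rw [this, h]
  have hx := poisson_gen hp φ a hx0 (xA p) (self _) zx
  have hz := poisson_gen hp φ a hx0 (zA p) (sw _ _ zx) (self _)
  exact poisson_gen hp φ a hx0 g (sw _ _ (hx g)) (sw _ _ (hz g)) f

namespace RelData

variable {p q : ℂ[X]} {hp : p ≠ 0} {hq : q ≠ 0} (D : RelData p q hp hq)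

/-- The correspondence holds after multiplication by large powers of `x`. -/
lemma stepF1 {s ζ : KK} {α : ℂ} (hs0 : s ≠ 0)
    (hk : ∀ k : ℕ, ∃ N : ℕ, ∀ i : ℕ, N ≤ i →
      D.R (mo i (X ^ k)) (algebraMap ℂ KK α * s ^ i * ζ ^ k)) (f : ODan p) :
    ∃ N : ℕ, ∀ n : ℕ, N ≤ n →
      D.R (iota p (xA p ^ n * f)) (algebraMap ℂ KK α * phi p s ζ hs0 (xA p ^ n * f)) := by
  have h1 : ∀ c : ℂ[X], ∃ N : ℕ, ∀ n : ℕ, N ≤ n → D.R (iota p (xA p ^ n * aeval (zA p) c))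
      (algebraMap ℂ KK α * phi p s ζ hs0 (xA p ^ n * aeval (zA p) c)) := by
    intro c
    induction c using Polynomial.induction_on' with
    | add c d hc hd =>
      obtain ⟨N, hN⟩ := hc
      obtain ⟨M, hM⟩ := hd
      refine ⟨N + M, fun n hn => ?_⟩
      have := D.add (hN n (by omega)) (hM n (by omega))
      rwa [map_add, mul_add, map_add, map_add, mul_add]
    | monomial k b =>
      obtain ⟨N, hN⟩ := hk k
      refine ⟨N, fun n hn => ?_⟩
      have := D.smul b (hN n hn)
      convert this using 1
      · rw [map_mul, map_pow, iota_x, iota_zc, aeval_monomial, mo]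
        simp only [zpow_natCast, map_pow, aeval_X]
        ring
      · rw [map_mul, map_pow, phi_x, phi_zc, aeval_monomial]
        ring
  obtain ⟨b, rfl⟩ := Nf_surj p f
  induction b using Finsupp.induction_linear with
  | zero =>
    refine ⟨0, fun n _ => ?_⟩
    simpa using D.cc 0 0
  | add f g hf hg =>
    obtain ⟨N, hN⟩ := hf
    obtain ⟨M, hM⟩ := hg
    refine ⟨N + M, fun n hn => ?_⟩
    have := D.add (hN n (by omega)) (hM n (by omega))
    rwa [map_add, mul_add, map_add, map_add, mul_add]
  | single i c =>
    obtain ⟨N, hN⟩ := h1 (p ^ (-i).toNat * c)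
    refine ⟨N + (-i).toNat, fun n hn => ?_⟩
    obtain ⟨m, rfl⟩ := Nat.exists_eq_add_of_le hn
    have := hN (N + m + i.toNat) (by omega)
    have e : xA p ^ (N + (-i).toNat + m) * Nf p (Finsupp.single i c) =
        xA p ^ (N + m + i.toNat) * aeval (zA p) (p ^ (-i).toNat * c) := by
      rw [Nf_single, nf_apply, map_mul, map_pow, ← xA_mul_yA, mul_pow]
      ring
    rwa [e]

/-- The correspondence is given by the homomorphism. -/
lemma stepF2 {s ζ : KK} {α : ℂ} (hα : α ≠ 0) (hs0 : s ≠ 0) (hs : ¬ IsC s)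
    (hx : ∀ i : ℕ, D.R (xK ^ i) (algebraMap ℂ KK α * s ^ i))
    (hζ : algebraMap ℂ KK α * br ζ s = s)
    (hk : ∀ k : ℕ, ∃ N : ℕ, ∀ i : ℕ, N ≤ i →
      D.R (mo i (X ^ k)) (algebraMap ℂ KK α * s ^ i * ζ ^ k)) (f : ODan p)
    (hf : iota p f ∈ WW p hp) :
    D.R (iota p f) (algebraMap ℂ KK α * phi p s ζ hs0 f) := by
  have := KK_char
  set a := algebraMap ℂ KK α with ha
  have ha0 : a ≠ 0 := by rw [ha]; simpa using hα
  have hbl : ∀ f g, br (a * f) g = a * br f g := br_C_left α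
  have hbr : ∀ f g, br f (a * g) = a * br f g := br_C_right α
  obtain ⟨u, hu⟩ := D.ex hf
  set φ := phi p s ζ hs0 with hφ
  have φx : φ (xA p) = s := phi_x p s ζ hs0
  have φz : φ (zA p) = ζ := phi_z p s ζ hs0
  have P := poisson_all hp φ a (by rw [φx]; exact hs0) (by rw [φx, φz]; exact hζ)
  have hF1 := fun f => D.stepF1 (α := α) hs0 hk f
  rw [← hφ, ← ha] at hF1
  set G := u - a * φ f with hG
  have key : ∀ g : ODan p, (∃ N : ℕ, ∀ n, N ≤ n → D.R (iota p (xA p ^ n * g)) (a * φ (xA p ^ n * g))) →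
      ∃ N : ℕ, ∀ n, N ≤ n → IsC (a * br G (s ^ n * φ g)) := by
    rintro g ⟨N, hN⟩
    obtain ⟨M1, hM1⟩ := hF1 (g * pb p f (xA p))
    obtain ⟨M2, hM2⟩ := hF1 (pb p f g)
    refine ⟨N + M1 + M2 + 1, fun n hn => ?_⟩
    obtain ⟨m, rfl⟩ : ∃ m, n = m + 1 := ⟨n - 1, by omega⟩
    have r1 := D.brk hu (hN (m + 1) (by omega))
    have r2 := D.add (hM2 (m + 1) (by omega)) (D.smul ((m : ℂ) + 1) (hM1 m (by omega)))
    have e : br (iota p f) (iota p (xA p ^ (m + 1) * g)) = iota p (xA p ^ (m + 1) * pb p f g) +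
        algebraMap ℂ KK ((m : ℂ) + 1) * iota p (xA p ^ m * (g * pb p f (xA p))) := by
      simp only [map_mul, map_pow, br_mul_right, br_pow_right, iota_pb, map_add, map_one, map_natCast]
      ring
    rw [e] at r1
    convert D.uniq r1 r2 using 1
    rw [hbr, hG, br_sub_left, hbl]
    simp only [map_mul, map_pow, br_mul_right, br_pow_right, P, map_add, map_one, map_natCast, φx]
    ring
  have ku : ∀ i : ℕ, D.R (iota p (xA p ^ i * 1)) (a * φ (xA p ^ i * 1)) := by
    intro i
    rw [mul_one, map_pow, map_pow, iota_x, φx]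
    exact hx i
  have Gs : br G s = 0 := by
    obtain ⟨N, hN⟩ := key 1 ⟨0, fun n _ => ku n⟩
    have h0 := constpow (B := a * br G s) hs N fun i hi => by
      have h1 := hN (i + 1) (by omega)
      have h2 := h1.cmul ((i + 1 : ℕ) : ℂ)⁻¹
      convert h2 using 1
      rw [map_one, mul_one, br_pow_right, map_inv₀, map_natCast]
      have : (i : KK) + 1 ≠ 0 := by exact_mod_cast Nat.succ_ne_zero i
      push_cast
      field_simp
    exact (mul_eq_zero.1 h0).resolve_left ha0
  have Gζ : br G ζ = 0 := by
    obtain ⟨N, hN⟩ := key (zA p) (hF1 (zA p))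
    have h0 := constpow (B := a * br G ζ) hs (N + 1) fun i hi => by
      have h1 := hN i (by omega)
      convert h1 using 1
      obtain ⟨m, rfl⟩ : ∃ m, i = m + 1 := ⟨i - 1, by omega⟩
      rw [φz, br_mul_right, br_pow_right, Gs]
      ring
    exact (mul_eq_zero.1 h0).resolve_left ha0
  have hsζ : br ζ s ≠ 0 := by
    intro h0
    rw [h0, mul_zero] at hζ
    exact hs0 hζ.symm
  have hGc : IsC G := by
    apply casimir'
    intro b
    have := br_plucker G ζ b s
    rw [Gs, Gζ, zero_mul, zero_mul, add_zero] at this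
    exact (mul_eq_zero.1 this).resolve_right hsζ
  refine D.shift hu ?_
  have := hGc.cmul (-1)
  convert this using 1
  rw [hG, map_neg, map_one]; ring

end RelData

/-- The algebra isomorphism produced by the correspondence. -/
lemma RelData.stepG {p q : ℂ[X]} {hp : p ≠ 0} {hq : q ≠ 0} (D : RelData p q hp hq)
    (hsp : Squarefree p) (hsq : Squarefree q) (hp2 : 2 ≤ p.natDegree) (hq2 : 2 ≤ q.natDegree) :
    ∃ (e : ODan p ≃ₐ[ℂ] ODan q) (α : ℂ),
      (∀ f, iota p f ∈ WW p hp → D.R (iota p f) (algebraMap ℂ KK α * iota q (e f))) ∧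
      ∀ f g, iota q (e (pb p f g)) = algebraMap ℂ KK α * br (iota q (e f)) (iota q (e g)) := by
  obtain ⟨s, α, hα, hs, hx⟩ := D.stepC hp2 hq2
  have hs0 : s ≠ 0 := by rintro rfl; exact hs IsC.zero
  obtain ⟨ζ, hζ, hk⟩ := D.stepE2 hp2 hq2 hα hs hx
  have hR := D.stepF2 hα hs0 hs hx hζ hk
  have hF1 := D.stepF1 (α := α) hs0 hk
  have P := poisson_all hp (phi p s ζ hs0) (algebraMap ℂ KK α) (by rw [phi_x]; exact hs0)
    (by rw [phi_x, phi_z]; exact hζ)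
  have hxne : ∀ n, phi p s ζ hs0 (xA p ^ n) ≠ 0 := by
    intro n; rw [map_pow, phi_x]; exact pow_ne_zero _ hs0
  generalize phi p s ζ hs0 = φ at hR hF1 P hxne
  have ha0 : algebraMap ℂ KK α ≠ 0 := by simpa using hα
  have hrange : ∀ f, φ f ∈ (iota q).range := by
    refine range_le_of_WW hp hsp hp2 φ _ fun f hf => ?_
    obtain ⟨u, hu, -⟩ := D.memR (hR f hf)
    refine ⟨α⁻¹ • u, ?_⟩
    change iota q (α⁻¹ • u) = φ f
    rw [map_smul, hu, ← Algebra.smul_def, smul_smul, inv_mul_cancel₀ hα, one_smul]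
  let ψ : ODan p →ₐ[ℂ] ODan q :=
    ((AlgEquiv.ofInjective (iota q) (iota_inj hq)).symm : (iota q).range →ₐ[ℂ] ODan q).comp
      (φ.codRestrict (iota q).range hrange)
  have hψ : ∀ f, iota q (ψ f) = φ f := by
    intro f
    have := AlgEquiv.apply_symm_apply (AlgEquiv.ofInjective (iota q) (iota_inj hq))
      (φ.codRestrict (iota q).range hrange f)
    exact congrArg Subtype.val this
  have hsurj : Function.Surjective ψ := by
    intro g
    refine range_le_of_WW hq hsq hq2 (AlgHom.id ℂ (ODan q)) ψ.range (fun g hg => ?_) g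
    obtain ⟨f, hf⟩ := D.ex' hg
    obtain ⟨f', hf', -⟩ := D.memL hf
    subst hf'
    obtain ⟨c, hc⟩ := D.uniq hf (hR f' (D.memL hf))
    refine ⟨α • f' + algebraMap ℂ _ c, ?_⟩
    apply iota_inj hq
    change iota q (ψ (α • f' + algebraMap ℂ _ c)) = iota q g
    rw [hψ, map_add, map_smul, AlgHom.commutes, ← hc, Algebra.smul_def]
    ring
  have hinj : Function.Injective ψ := by
    rw [injective_iff_map_eq_zero]
    intro f hf
    have hf0 : φ f = 0 := by rw [← hψ, hf, map_zero]
    obtain ⟨N, hN⟩ := hF1 f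
    have h1 := hN N le_rfl
    rw [map_mul φ, hf0, mul_zero, mul_zero] at h1
    obtain ⟨c, hc⟩ := D.const h1 IsC.zero
    have h2 : xA p ^ N * f = algebraMap ℂ _ c := by
      apply iota_inj hp
      rw [hc, AlgHom.commutes]
    have h3 : algebraMap ℂ KK c = 0 := by
      rw [← AlgHom.commutes φ, ← h2, map_mul, hf0, mul_zero]
    rw [h3, map_mul, map_pow, iota_x] at hc
    apply iota_inj hp
    rw [map_zero]
    exact (mul_eq_zero.1 hc).resolve_left (pow_ne_zero _ xK_ne)
  refine ⟨AlgEquiv.ofBijective ψ ⟨hinj, hsurj⟩, α, fun f hf => ?_, fun f g => ?_⟩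
  · have := hR f hf
    rwa [← hψ] at this
  · have := P f g
    rwa [← hψ, ← hψ, ← hψ] at this
/-- Let `p, q` be squarefree with `2 ≤ deg p ≤ deg q` and `3 ≤ deg q`.  Any isomorphism
of Lie algebras `F : ⟨LND(D_p)⟩ → ⟨LND(D_q)⟩` is induced by an isomorphism of varieties
`D_p ≅ D_q`: there is a `ℂ`-algebra isomorphism `φ* : O(D_q) → O(D_p)` with
`F(δ) = (φ*)⁻¹ ∘ δ ∘ φ*` for all `δ ∈ ⟨LND(D_p)⟩`. -/
theorem lndSpan_equiv_induced (p q : ℂ[X])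
    (hsp : Squarefree p) (hsq : Squarefree q)
    (hp2 : 2 ≤ p.natDegree) (hpq : p.natDegree ≤ q.natDegree) (hq3 : 3 ≤ q.natDegree)
    (F : lndSpan p ≃ₗ⁅ℂ⁆ lndSpan q) :
    ∃ φ : ODan q ≃ₐ[ℂ] ODan p, ∀ d : lndSpan p, ∀ g : ODan q,
      ((F d : lndSpan q) : Derivation ℂ (ODan q) (ODan q)) g =
        φ.symm (((d : lndSpan p) : Derivation ℂ (ODan p) (ODan p)) (φ g)) := by
  have hp : p ≠ 0 := by rintro rfl; simp at hp2
  have hq : q ≠ 0 := by rintro rfl; simp at hq3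
  have hq2 : 2 ≤ q.natDegree := by omega
  obtain ⟨e, α, hR, hP⟩ := (relData hp hq hsp hsq hp2 hq2 F).stepG hsp hsq hp2 hq2
  refine ⟨e.symm, fun d g => ?_⟩
  rw [AlgEquiv.symm_symm]
  obtain ⟨d, hd⟩ := d
  obtain ⟨f, rfl⟩ := span_isHam hsp hp2 hp hd
  obtain ⟨f', u, hf', h1, h2, h3⟩ : relOf hp hq F _ _ := hR f ⟨f, rfl, hd⟩
  obtain rfl := iota_inj hp h1
  rw [h3]
  apply iota_inj hq
  rw [iota_ham, h2, br_C_left]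
  change _ = iota q (e (pb p f' (e.symm g)))
  rw [hP, AlgEquiv.apply_symm_apply]

end
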